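/- arXiv:2507.02552 — 7 statements merged into one kernel-verified Lean document; each statement's English description precedes it below -/
import Mathlib

section
/- Minimax detection lower bound in the isotropic case (Theorem 1(i)). Let n, p, 𝔰, Δ be positive integers with 1 ≤ 𝔰 ≤ p and 1 ≤ Δ ≤ n/4, let σ > 0 and τ > 0. Assume 𝔰·log(1 + max(p/𝔰², √p/𝔰)) ≤ √((25/2)·log(17/(12√2))·Δ) and τ ≤ (2/5)·log(17/(12√2)). Then for every measurable estimator θ̂ : (ℝ^p × ℝ)^n → ℝ there exist a change point θ ∈ {1,…,n} with min(θ, n − θ) = Δ and vectors β₀, β₁ ∈ ℝ^p such that δ := β₁ − β₀ has exactly 𝔰 nonzero coordinates, ‖δ‖₂²·Δ ≥ τ·Ψ²·𝔰·log(1 + max(p/𝔰², √p/𝔰)) with Ψ = max(‖β₀‖₂, ‖β₁‖₂, σ), and, under the joint law P_{θ,β₀,β₁} of the sample, P_{θ,β₀,β₁}( |θ̂((x_t, Y_t)_{t=1}^n) − θ| ≥ Δ ) ≥ 1/25. -/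
open MeasureTheory ProbabilityTheory Matrix
open scoped ENNReal

/-- The Euclidean (ℓ₂) norm of a vector in `ℝ^p`. -/
noncomputable def l2norm {p : ℕ} (v : Fin p → ℝ) : ℝ :=
  Real.sqrt (∑ i, v i ^ 2)

/-- The standard Gaussian measure on `ℝ^p` (i.i.d. standard normal coordinates). -/
noncomputable def stdGaussianVec (p : ℕ) : Measure (Fin p → ℝ) :=
  Measure.pi fun _ => gaussianReal 0 1

/-- The joint law `P_{θ,β₀,β₁}` of the sample `((x_t, Y_t))_{t=1}^n` in the AMOC Gaussian
linear model: `x_t = Σ^{1/2} z_t` with `z_t` i.i.d. standard Gaussian on `ℝ^p` and,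
independently, `ε_t` i.i.d. `N(0, σ²)`, with `Y_t = x_tᵀβ₀ + ε_t` for `t ≤ θ` and
`Y_t = x_tᵀβ₁ + ε_t` for `t > θ` (here `t : Fin n` represents the time `t + 1`,
and `Shalf` plays the role of `Σ^{1/2}`). -/
noncomputable def amocLaw (n p : ℕ) (Shalf : Matrix (Fin p) (Fin p) ℝ)
    (β₀ β₁ : Fin p → ℝ) (σ : ℝ) (θ : ℕ) :
    Measure (Fin n → (Fin p → ℝ) × ℝ) :=
  Measure.map
    (fun ω : (Fin n → Fin p → ℝ) × (Fin n → ℝ) => fun t : Fin n =>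
      (Shalf.mulVec (ω.1 t),
        (∑ i, Shalf.mulVec (ω.1 t) i * (if (t : ℕ) < θ then β₀ i else β₁ i)) + ω.2 t))
    ((Measure.pi fun _ : Fin n => stdGaussianVec p).prod
      (Measure.pi fun _ : Fin n => gaussianReal 0 (Real.toNNReal (σ ^ 2))))

section PiMeasures

variable {ι : Type*} [Fintype ι] {X : ι → Type*} [∀ i, MeasurableSpace (X i)]

lemma lintegral_pi_prod (μ : ∀ i, Measure (X i)) [∀ i, IsProbabilityMeasure (μ i)]
    {f : ∀ i, X i → ℝ≥0∞} (hf : ∀ i, Measurable (f i)) :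
    ∫⁻ x, ∏ i, f i (x i) ∂Measure.pi μ = ∏ i, ∫⁻ x, f i x ∂μ i := by
  have hind : iIndepFun (fun i (x : ∀ i, X i) => f i (x i)) (Measure.pi μ) :=
    iIndepFun_pi (fun i => (hf i).aemeasurable)
  rw [lintegral_prod_eq_prod_lintegral_of_indepFun Finset.univ _ hind
    (fun i => (hf i).comp (measurable_pi_apply i))]
  refine Finset.prod_congr rfl fun i _ => ?_
  exact (measurePreserving_eval μ i).lintegral_comp (hf i)

lemma pi_withDensity (μ : ∀ i, Measure (X i)) [∀ i, IsProbabilityMeasure (μ i)]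
    {f : ∀ i, X i → ℝ≥0∞} (hf : ∀ i, Measurable (f i))
    [∀ i, IsProbabilityMeasure ((μ i).withDensity (f i))] :
    Measure.pi (fun i => (μ i).withDensity (f i))
      = (Measure.pi μ).withDensity (fun x => ∏ i, f i (x i)) := by
  classical
  refine Measure.pi_eq fun s hs => ?_
  rw [withDensity_apply _ (MeasurableSet.univ_pi hs),
    ← lintegral_indicator (MeasurableSet.univ_pi hs)]
  have hind : (Set.univ.pi s).indicator (fun x : ∀ i, X i => ∏ i, f i (x i))
      = fun x => ∏ i, (s i).indicator (f i) (x i) := by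
    funext x
    by_cases hx : x ∈ Set.univ.pi s
    · rw [Set.indicator_of_mem hx]
      exact Finset.prod_congr rfl fun i _ =>
        (Set.indicator_of_mem (hx i (Set.mem_univ i)) _).symm
    · rw [Set.indicator_of_notMem hx]
      obtain ⟨i, hi⟩ : ∃ i, x i ∉ s i := by simpa using hx
      exact (Finset.prod_eq_zero (Finset.mem_univ i) (Set.indicator_of_notMem hi _)).symm
  rw [hind, lintegral_pi_prod μ fun i => (hf i).indicator (hs i)]
  refine Finset.prod_congr rfl fun i _ => ?_
  rw [withDensity_apply _ (hs i), lintegral_indicator (hs i)]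

end PiMeasures

section Observation

variable {p : ℕ}

instance : IsProbabilityMeasure (stdGaussianVec p) := by
  unfold stdGaussianVec; infer_instance

/-- The law of a covariate `x ~ N(0, I)` together with an independent response of
variance `v`. -/
noncomputable def nullLaw (p : ℕ) (v : NNReal) : Measure ((Fin p → ℝ) × ℝ) :=
  (stdGaussianVec p).prod (gaussianReal 0 v)

instance (v : NNReal) : IsProbabilityMeasure (nullLaw p v) := by
  unfold nullLaw; infer_instance

/-- The law of a single observation `(x, xᵀβ + ε)`. -/
noncomputable def regressionLaw (v : NNReal) (β : Fin p → ℝ) : Measure ((Fin p → ℝ) × ℝ) :=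
  (nullLaw p v).map fun ω => (ω.1, ω.1 ⬝ᵥ β + ω.2)

/-- The likelihood ratio of `regressionLaw v β` with respect to `nullLaw p v`. -/
noncomputable def likelihoodRatio (v : NNReal) (β : Fin p → ℝ) (ω : (Fin p → ℝ) × ℝ) : ℝ≥0∞ :=
  ENNReal.ofReal (Real.exp ((ω.2 * (ω.1 ⬝ᵥ β) - (ω.1 ⬝ᵥ β) ^ 2 / 2) / v))

@[fun_prop]
lemma measurable_dotProduct_const (β : Fin p → ℝ) : Measurable fun x : Fin p → ℝ => x ⬝ᵥ β := by
  unfold dotProduct; fun_prop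

@[fun_prop]
lemma measurable_likelihoodRatio (v : NNReal) (β : Fin p → ℝ) :
    Measurable (likelihoodRatio v β) := by
  unfold likelihoodRatio; fun_prop

instance (v : NNReal) (β : Fin p → ℝ) : IsProbabilityMeasure (regressionLaw v β) :=
  Measure.isProbabilityMeasure_map (by fun_prop)

lemma gaussianReal_eq_withDensity {v : NNReal} (hv : v ≠ 0) (m : ℝ) :
    gaussianReal m v = (gaussianReal 0 v).withDensity
      fun y => ENNReal.ofReal (Real.exp ((y * m - m ^ 2 / 2) / v)) := by
  have hv' : (v : ℝ) ≠ 0 := by exact_mod_cast hv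
  rw [gaussianReal_of_var_ne_zero _ hv, gaussianReal_of_var_ne_zero _ hv,
    ← withDensity_mul _ (measurable_gaussianPDF 0 v) (by fun_prop)]
  congr 1
  funext y
  simp only [Pi.mul_apply, gaussianPDF, gaussianPDFReal]
  rw [← ENNReal.ofReal_mul (by positivity), mul_assoc _ (Real.exp _), ← Real.exp_add]
  congr 3
  field_simp
  ring

lemma regressionLaw_eq_withDensity {v : NNReal} (hv : v ≠ 0) (β : Fin p → ℝ) :
    regressionLaw v β = (nullLaw p v).withDensity (likelihoodRatio v β) := by
  refine Measure.ext_of_lintegral _ fun f hf => ?_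
  rw [regressionLaw, lintegral_map hf (by fun_prop),
    lintegral_withDensity_eq_lintegral_mul _ (by fun_prop) hf, nullLaw,
    lintegral_prod _ (by fun_prop), lintegral_prod _ (by fun_prop)]
  refine lintegral_congr fun x => ?_
  have hshift : gaussianReal (x ⬝ᵥ β) v = (gaussianReal 0 v).map (x ⬝ᵥ β + ·) := by
    rw [gaussianReal_map_const_add, zero_add]
  have h := lintegral_map (μ := gaussianReal 0 v) (f := fun y => f (x, y)) (g := (x ⬝ᵥ β + ·))
    (by fun_prop) (by fun_prop)
  rw [← hshift, gaussianReal_eq_withDensity hv,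
    lintegral_withDensity_eq_lintegral_mul _ (by fun_prop) (by fun_prop)] at h
  exact h.symm

lemma amocLaw_one_eq_pi (n : ℕ) (β₀ β₁ : Fin p → ℝ) (σ : ℝ) (θ : ℕ) :
    amocLaw n p 1 β₀ β₁ σ θ
      = Measure.pi fun t : Fin n =>
          regressionLaw (σ ^ 2).toNNReal (if (t : ℕ) < θ then β₀ else β₁) := by
  have hmp := measurePreserving_arrowProdEquivProdArrow (Fin p → ℝ) ℝ (Fin n)
    (fun _ => stdGaussianVec p) (fun _ => gaussianReal 0 (σ ^ 2).toNNReal)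
  unfold amocLaw regressionLaw
  rw [← hmp.map_eq, Measure.map_map, ← Measure.pi_map_pi]
  · congr 1
    funext ω t
    simp [Function.comp, MeasurableEquiv.arrowProdEquivProdArrow, Equiv.arrowProdEquivProdArrow,
      dotProduct]
    split_ifs <;> rfl
  · intro t; fun_prop
  · simp only [one_mulVec]
    refine measurable_pi_lambda _ fun t => ?_
    split_ifs <;> fun_prop
  · exact hmp.measurable

lemma lintegral_likelihoodRatio_mul {v : NNReal} (hv : v ≠ 0) (β γ : Fin p → ℝ) :
    ∫⁻ ω, likelihoodRatio v β ω * likelihoodRatio v γ ω ∂nullLaw p v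
      = ∫⁻ x, ENNReal.ofReal (Real.exp ((x ⬝ᵥ β) * (x ⬝ᵥ γ) / v)) ∂stdGaussianVec p := by
  have hv' : (v : ℝ) ≠ 0 := by exact_mod_cast hv
  rw [nullLaw, lintegral_prod _ (by fun_prop)]
  refine lintegral_congr fun x => ?_
  have hsplit (y : ℝ) : likelihoodRatio v β (x, y) * likelihoodRatio v γ (x, y)
      = ENNReal.ofReal (Real.exp ((x ⬝ᵥ β) * (x ⬝ᵥ γ) / v)) *
        ENNReal.ofReal (Real.exp ((y * (x ⬝ᵥ β + x ⬝ᵥ γ) - (x ⬝ᵥ β + x ⬝ᵥ γ) ^ 2 / 2) / v)) := by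
    simp only [likelihoodRatio]
    rw [← ENNReal.ofReal_mul (by positivity), ← ENNReal.ofReal_mul (by positivity),
      ← Real.exp_add, ← Real.exp_add]
    congr 2
    field_simp
    ring
  simp only [hsplit]
  rw [lintegral_const_mul _ (by fun_prop), ← setLIntegral_univ,
    ← withDensity_apply _ MeasurableSet.univ, ← gaussianReal_eq_withDensity hv, measure_univ,
    mul_one]

end Observation

section GaussianMoments

variable {p : ℕ}

lemma stdGaussianVec_map_dotProduct (w : Fin p → ℝ) :
    (stdGaussianVec p).map (fun x => x ⬝ᵥ w) = gaussianReal 0 (w ⬝ᵥ w).toNNReal := by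
  have hw : 0 ≤ w ⬝ᵥ w := Finset.sum_nonneg fun i _ => mul_self_nonneg _
  have := Measure.isProbabilityMeasure_map (μ := stdGaussianVec p)
    (f := fun x => x ⬝ᵥ w) (by fun_prop)
  refine Measure.ext_of_charFun ?_
  funext t
  rw [charFun_apply_real, integral_map (by fun_prop) (by fun_prop), charFun_gaussianReal,
    Real.coe_toNNReal _ hw]
  have hprod (x : Fin p → ℝ) : Complex.exp (t * ((x ⬝ᵥ w : ℝ) : ℂ) * Complex.I)
      = ∏ i, Complex.exp (((t * w i : ℝ) : ℂ) * (x i : ℂ) * Complex.I) := by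
    rw [← Complex.exp_sum]
    congr 1
    simp only [dotProduct, Complex.ofReal_sum, Finset.mul_sum, Finset.sum_mul]
    refine Finset.sum_congr rfl fun i _ => ?_
    push_cast; ring
  simp only [hprod]
  rw [stdGaussianVec, integral_fintype_prod_eq_prod
    (f := fun i (y : ℝ) => Complex.exp (((t * w i : ℝ) : ℂ) * (y : ℂ) * Complex.I))]
  simp only [← charFun_apply_real, charFun_gaussianReal]
  rw [← Complex.exp_sum]
  congr 1
  simp only [dotProduct, Complex.ofReal_sum, Finset.sum_mul, Finset.sum_div]
  simp only [Complex.ofReal_zero, mul_zero, zero_mul, zero_sub, Finset.sum_neg_distrib]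
  congr 1
  refine Finset.sum_congr rfl fun i _ => ?_
  push_cast; ring

/-- The exponential moment of a centred Gaussian square, bounded near the origin. -/
lemma lintegral_exp_mul_sq_gaussianReal_le (v : NNReal) (c : ℝ) (hc : 2 * c * v ≤ 1 / 2) :
    ∫⁻ x, ENNReal.ofReal (Real.exp (c * x ^ 2)) ∂gaussianReal 0 v
      ≤ ENNReal.ofReal (Real.exp ((2 * c * v + (2 * c * v) ^ 2) / 2)) := by
  rcases eq_or_ne v 0 with rfl | hv
  · simp [gaussianReal_zero_var]
  have hv0 : (0 : ℝ) < v := by exact_mod_cast pos_iff_ne_zero.mpr hv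
  set y : ℝ := 2 * c * v with hy
  have hb : 0 < (1 - y) / (2 * v) := by apply div_pos <;> linarith
  rw [gaussianReal_of_var_ne_zero _ hv,
    lintegral_withDensity_eq_lintegral_mul _ (measurable_gaussianPDF 0 v) (by fun_prop)]
  have hpt (x : ℝ) : (gaussianPDF 0 v * fun x => ENNReal.ofReal (Real.exp (c * x ^ 2))) x
      = ENNReal.ofReal ((√(2 * Real.pi * v))⁻¹ * Real.exp (-((1 - y) / (2 * v)) * x ^ 2)) := by
    simp only [Pi.mul_apply, gaussianPDF, gaussianPDFReal]
    rw [← ENNReal.ofReal_mul (by positivity), mul_assoc, ← Real.exp_add]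
    congr 3
    rw [hy]
    field_simp
    ring
  simp only [hpt]
  rw [← ofReal_integral_eq_lintegral_ofReal ((integrable_exp_neg_mul_sq hb).const_mul _)
    (Filter.Eventually.of_forall fun x => by positivity), integral_const_mul, integral_gaussian]
  refine ENNReal.ofReal_le_ofReal ?_
  have hpi := Real.pi_pos
  rw [← Real.sqrt_inv, ← Real.sqrt_mul (by positivity)]
  refine Real.sqrt_le_iff.mpr ⟨by positivity, ?_⟩
  rw [← Real.exp_nat_mul]
  have h1y : 0 < 1 - y := by linarith
  have hval : (2 * Real.pi * v)⁻¹ * (Real.pi / ((1 - y) / (2 * v))) = (1 - y)⁻¹ := by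
    field_simp
  rw [hval]
  have hexp : ((2 : ℕ) : ℝ) * ((y + y ^ 2) / 2) = y + y ^ 2 := by push_cast; ring
  rw [hexp, inv_le_iff_one_le_mul₀ h1y]
  rcases le_total 0 y with hy0 | hy0
  · have hquad := Real.quadratic_le_exp_of_nonneg (x := y + y ^ 2) (by positivity)
    have hpoly : 1 ≤ (1 - y) * (1 + (y + y ^ 2) + (y + y ^ 2) ^ 2 / 2) := by
      nlinarith [mul_nonneg (sq_nonneg y) (sub_nonneg.mpr hc), mul_nonneg (sq_nonneg y) hy0,
        mul_nonneg (mul_nonneg (sq_nonneg y) hy0) (sub_nonneg.mpr hc),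
        mul_nonneg (mul_nonneg (sq_nonneg y) (sq_nonneg y)) (sub_nonneg.mpr hc)]
    nlinarith [mul_le_mul_of_nonneg_left hquad h1y.le]
  · have hlin := Real.add_one_le_exp (y + y ^ 2)
    nlinarith [mul_le_mul_of_nonneg_left hlin h1y.le, mul_nonneg (sq_nonneg y) (neg_nonneg.mpr hy0)]

lemma lintegral_exp_mul_sq_dotProduct_le (w : Fin p → ℝ) (c : ℝ) (hc : 2 * c * (w ⬝ᵥ w) ≤ 1 / 2) :
    ∫⁻ x, ENNReal.ofReal (Real.exp (c * (x ⬝ᵥ w) ^ 2)) ∂stdGaussianVec p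
      ≤ ENNReal.ofReal (Real.exp ((2 * c * (w ⬝ᵥ w) + (2 * c * (w ⬝ᵥ w)) ^ 2) / 2)) := by
  have hw : 0 ≤ w ⬝ᵥ w := Finset.sum_nonneg fun i _ => mul_self_nonneg _
  have h := lintegral_exp_mul_sq_gaussianReal_le (w ⬝ᵥ w).toNNReal c
    (by rwa [Real.coe_toNNReal _ hw])
  rwa [← stdGaussianVec_map_dotProduct, lintegral_map (by fun_prop) (by fun_prop),
    Real.coe_toNNReal _ hw] at h

lemma lintegral_exp_dotProduct_mul_le {β γ : Fin p → ℝ} {v a b : ℝ} (hv : 0 < v)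
    (hβ : β ⬝ᵥ β = b * v) (hγ : γ ⬝ᵥ γ = b * v) (hβγ : β ⬝ᵥ γ = a * v) (hb : 4 * b ≤ 1 / 2) :
    ∫⁻ x, ENNReal.ofReal (Real.exp ((x ⬝ᵥ β) * (x ⬝ᵥ γ) / v)) ∂stdGaussianVec p
      ≤ ENNReal.ofReal (Real.exp (a + 4 * b ^ 2)) := by
  have hadd : (β + γ) ⬝ᵥ (β + γ) = 2 * (b + a) * v := by
    rw [add_dotProduct, dotProduct_add, dotProduct_add, dotProduct_comm γ β, hβ, hγ, hβγ]; ring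
  have hsub : (β - γ) ⬝ᵥ (β - γ) = 2 * (b - a) * v := by
    rw [sub_dotProduct, dotProduct_sub, dotProduct_sub, dotProduct_comm γ β, hβ, hγ, hβγ]; ring
  have hadd0 : 0 ≤ (β + γ) ⬝ᵥ (β + γ) := Finset.sum_nonneg fun i _ => mul_self_nonneg _
  have hsub0 : 0 ≤ (β - γ) ⬝ᵥ (β - γ) := Finset.sum_nonneg fun i _ => mul_self_nonneg _
  rw [hadd] at hadd0
  rw [hsub] at hsub0
  have hab : 0 ≤ b + a := by nlinarith [nonneg_of_mul_nonneg_left hadd0 hv]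
  have hba : 0 ≤ b - a := by nlinarith [nonneg_of_mul_nonneg_left hsub0 hv]
  have hcadd : 2 * (1 / (2 * v)) * ((β + γ) ⬝ᵥ (β + γ)) = 2 * (b + a) := by
    rw [hadd]; field_simp
  have hcsub : 2 * (-1 / (2 * v)) * ((β - γ) ⬝ᵥ (β - γ)) = -(2 * (b - a)) := by
    rw [hsub]; field_simp
  have hplus := lintegral_exp_mul_sq_dotProduct_le (β + γ) (1 / (2 * v)) (by rw [hcadd]; linarith)
  have hminus := lintegral_exp_mul_sq_dotProduct_le (β - γ) (-1 / (2 * v))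
    (by rw [hcsub]; linarith)
  rw [hcadd] at hplus
  rw [hcsub] at hminus
  set y := 2 * (b + a) with hy
  set z := -(2 * (b - a)) with hz
  set d := (z + z ^ 2) / 4 - (y + y ^ 2) / 4 with hd
  have hpt (x : Fin p → ℝ) : ENNReal.ofReal (Real.exp ((x ⬝ᵥ β) * (x ⬝ᵥ γ) / v))
      ≤ ENNReal.ofReal (Real.exp d / 2)
            * ENNReal.ofReal (Real.exp (1 / (2 * v) * (x ⬝ᵥ (β + γ)) ^ 2))
        + ENNReal.ofReal (Real.exp (-d) / 2)
            * ENNReal.ofReal (Real.exp (-1 / (2 * v) * (x ⬝ᵥ (β - γ)) ^ 2)) := by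
    rw [← ENNReal.ofReal_mul (by positivity), ← ENNReal.ofReal_mul (by positivity),
      ← ENNReal.ofReal_add (by positivity) (by positivity)]
    refine ENNReal.ofReal_le_ofReal ?_
    rw [dotProduct_add, dotProduct_sub, div_mul_eq_mul_div (Real.exp d),
      div_mul_eq_mul_div (Real.exp (-d)),
      ← Real.exp_add,
      ← Real.exp_add]
    set P := d + 1 / (2 * v) * (x ⬝ᵥ β + x ⬝ᵥ γ) ^ 2 with hP
    set N := -d + -1 / (2 * v) * (x ⬝ᵥ β - x ⬝ᵥ γ) ^ 2 with hN
    have hPN : (x ⬝ᵥ β) * (x ⬝ᵥ γ) / v = P / 2 + N / 2 := by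
      rw [hP, hN]; field_simp; ring
    have hP2 : Real.exp P = Real.exp (P / 2) ^ 2 := by
      rw [← Real.exp_nat_mul]; congr 1; push_cast; ring
    have hN2 : Real.exp N = Real.exp (N / 2) ^ 2 := by
      rw [← Real.exp_nat_mul]; congr 1; push_cast; ring
    rw [hPN, Real.exp_add, hP2, hN2]
    nlinarith [sq_nonneg (Real.exp (P / 2) - Real.exp (N / 2))]
  refine (lintegral_mono hpt).trans ?_
  rw [lintegral_add_left (by fun_prop), lintegral_const_mul _ (by fun_prop),
    lintegral_const_mul _ (by fun_prop)]
  refine (add_le_add (mul_le_mul_right hplus _) (mul_le_mul_right hminus _)).trans ?_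
  rw [← ENNReal.ofReal_mul (by positivity), ← ENNReal.ofReal_mul (by positivity),
    ← ENNReal.ofReal_add (by positivity) (by positivity)]
  refine ENNReal.ofReal_le_ofReal ?_
  rw [div_mul_eq_mul_div, div_mul_eq_mul_div, ← Real.exp_add, ← Real.exp_add]
  have hs₁ : d + (y + y ^ 2) / 2 = a + 2 * a ^ 2 + 2 * b ^ 2 := by rw [hd, hy, hz]; ring
  have hs₂ : -d + (z + z ^ 2) / 2 = a + 2 * a ^ 2 + 2 * b ^ 2 := by rw [hd, hy, hz]; ring
  rw [hs₁, hs₂, add_halves]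
  exact Real.exp_le_exp.mpr (by nlinarith)

end GaussianMoments

section Experiment

variable {n p : ℕ}

/-- The regression vectors equal to `δ` on the time points of `T` and to `0` elsewhere. -/
def signalOn (T : Finset (Fin n)) (δ : Fin p → ℝ) (t : Fin n) : Fin p → ℝ :=
  if t ∈ T then δ else 0

/-- The joint likelihood ratio of the independent observations with signal `δ` on `T`. -/
noncomputable def jointLikelihoodRatio (v : NNReal) (T : Finset (Fin n)) (δ : Fin p → ℝ)
    (ω : Fin n → (Fin p → ℝ) × ℝ) : ℝ≥0∞ :=
  ∏ t, likelihoodRatio v (signalOn T δ t) (ω t)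

lemma measurable_jointLikelihoodRatio (v : NNReal) (T : Finset (Fin n)) (δ : Fin p → ℝ) :
    Measurable (jointLikelihoodRatio v T δ) :=
  Finset.measurable_prod _ fun t _ =>
    (measurable_likelihoodRatio v _).comp (measurable_pi_apply t)

lemma pi_regressionLaw_eq_withDensity {v : NNReal} (hv : v ≠ 0) (T : Finset (Fin n))
    (δ : Fin p → ℝ) :
    Measure.pi (fun t => regressionLaw v (signalOn T δ t))
      = (Measure.pi fun _ : Fin n => nullLaw p v).withDensity (jointLikelihoodRatio v T δ) := by
  have hprob (t : Fin n) : IsProbabilityMeasure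
      ((nullLaw p v).withDensity (likelihoodRatio v (signalOn T δ t))) := by
    rw [← regressionLaw_eq_withDensity hv]; infer_instance
  simp only [regressionLaw_eq_withDensity hv]
  exact pi_withDensity (fun _ => nullLaw p v) fun t => measurable_likelihoodRatio v _

lemma lintegral_jointLikelihoodRatio_mul_le {v : NNReal} (hv : v ≠ 0) (T : Finset (Fin n))
    {β γ : Fin p → ℝ} {a b : ℝ} (hβ : β ⬝ᵥ β = b * v) (hγ : γ ⬝ᵥ γ = b * v)
    (hβγ : β ⬝ᵥ γ = a * v) (hb : 4 * b ≤ 1 / 2) :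
    ∫⁻ ω, jointLikelihoodRatio v T β ω * jointLikelihoodRatio v T γ ω
        ∂Measure.pi (fun _ : Fin n => nullLaw p v)
      ≤ ENNReal.ofReal (Real.exp (T.card * (a + 4 * b ^ 2))) := by
  have hv0 : (0 : ℝ) < v := by exact_mod_cast pos_iff_ne_zero.mpr hv
  simp only [jointLikelihoodRatio, ← Finset.prod_mul_distrib]
  rw [lintegral_pi_prod (fun _ => nullLaw p v)
    (f := fun t ω => likelihoodRatio v (signalOn T β t) ω * likelihoodRatio v (signalOn T γ t) ω)
    fun t => by fun_prop]
  rw [Real.exp_nat_mul, ENNReal.ofReal_pow (by positivity), ← Finset.prod_const,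
    ← Finset.prod_subset (Finset.subset_univ T)]
  · refine Finset.prod_le_prod' fun t ht => ?_
    rw [signalOn, signalOn, if_pos ht, if_pos ht, lintegral_likelihoodRatio_mul hv]
    exact lintegral_exp_dotProduct_mul_le hv0 hβ hγ hβγ hb
  · intro t _ ht
    simp [signalOn, if_neg ht, likelihoodRatio]

end Experiment

section Mixture

variable {Ω : Type*} [MeasurableSpace Ω]

lemma ENNReal.four_mul_mul_le_add_sq (N : ℕ) (x : ℝ≥0∞) :
    4 * N * x ≤ 4 * (N : ℝ≥0∞) ^ 2 + x ^ 2 := by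
  induction x with
  | top => simp
  | coe x =>
    have h : 4 * (N : NNReal) * x ≤ 4 * (N : NNReal) ^ 2 + x ^ 2 := by
      rw [← NNReal.coe_le_coe]; push_cast
      nlinarith [sq_nonneg (2 * (N : ℝ) - x)]
    exact_mod_cast h

/-- If the uniform mixture of the alternatives `Q.withDensity (L i)` has a small second moment,
an event of null probability at least `1/2` is charged by at least one of the alternatives. -/
lemma exists_withDensity_ge (Q : Measure Ω) [IsProbabilityMeasure Q] {ι : Type*} [Fintype ι]
    [Nonempty ι] {L : ι → Ω → ℝ≥0∞} (hL : ∀ i, Measurable (L i))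
    [∀ i, IsProbabilityMeasure (Q.withDensity (L i))] {A : Set Ω} (hA : MeasurableSet A)
    (hQ : 1 / 2 ≤ Q.real A) {V : ℝ} (hV0 : 0 ≤ V) (hV : V ≤ 46 / 25)
    (hLV : ∑ i, ∑ j, ∫⁻ ω, L i ω * L j ω ∂Q
      ≤ ENNReal.ofReal ((Fintype.card ι : ℝ) ^ 2 * V)) :
    ∃ i, (1 / 25 : ℝ≥0∞) ≤ Q.withDensity (L i) A := by
  set N := Fintype.card ι with hN
  have hNpos : 0 < N := Fintype.card_pos
  have hbound : 4 * (N : ℝ≥0∞) * ∑ i, Q.withDensity (L i) Aᶜ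
      ≤ 4 * (N : ℝ≥0∞) ^ 2 * Q Aᶜ + ENNReal.ofReal ((N : ℝ) ^ 2 * V) := by
    calc 4 * (N : ℝ≥0∞) * ∑ i, Q.withDensity (L i) Aᶜ
        = ∫⁻ ω in Aᶜ, 4 * (N : ℝ≥0∞) * ∑ i, L i ω ∂Q := by
          rw [lintegral_const_mul _ (by fun_prop), lintegral_finsetSum _ (by fun_prop)]
          simp only [withDensity_apply _ hA.compl]
      _ ≤ ∫⁻ ω in Aᶜ, 4 * (N : ℝ≥0∞) ^ 2 + (∑ i, L i ω) ^ 2 ∂Q :=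
          lintegral_mono fun ω => ENNReal.four_mul_mul_le_add_sq N _
      _ = 4 * (N : ℝ≥0∞) ^ 2 * Q Aᶜ + ∫⁻ ω in Aᶜ, (∑ i, L i ω) ^ 2 ∂Q := by
          rw [lintegral_add_left measurable_const, setLIntegral_const]
      _ ≤ 4 * (N : ℝ≥0∞) ^ 2 * Q Aᶜ + ∫⁻ ω, (∑ i, L i ω) ^ 2 ∂Q := by
          gcongr; exact Measure.restrict_le_self
      _ ≤ _ := by
          refine add_le_add le_rfl (le_trans (le_of_eq ?_) hLV)
          simp only [sq, Finset.sum_mul_sum]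
          rw [lintegral_finsetSum _ (by fun_prop)]
          exact Finset.sum_congr rfl fun i _ => lintegral_finsetSum _ (by fun_prop)
  have hreal : 4 * (N : ℝ) * ∑ i, (Q.withDensity (L i)).real Aᶜ
      ≤ 4 * (N : ℝ) ^ 2 * Q.real Aᶜ + (N : ℝ) ^ 2 * V := by
    have h := ENNReal.toReal_mono (by finiteness) hbound
    rw [ENNReal.toReal_add (by finiteness) (by finiteness),
      ENNReal.toReal_ofReal (by positivity)] at h
    simpa [ENNReal.toReal_mul, ENNReal.toReal_sum, measureReal_def] using h
  rw [probReal_compl_eq_one_sub hA] at hreal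
  simp only [probReal_compl_eq_one_sub hA] at hreal
  have hNR : (0 : ℝ) < N := by exact_mod_cast hNpos
  have hsum : ∑ _i : ι, (1 / 25 : ℝ) ≤ ∑ i, (Q.withDensity (L i)).real A := by
    rw [Finset.sum_sub_distrib] at hreal
    simp only [Finset.sum_const, Finset.card_univ, ← hN, nsmul_eq_mul, mul_one] at hreal ⊢
    have hle : 4 * (N : ℝ) * (N - ∑ i, (Q.withDensity (L i)).real A)
        ≤ 4 * (N : ℝ) * (24 / 25 * N) := by
      nlinarith [sq_nonneg (N : ℝ), mul_le_mul_of_nonneg_left hQ (sq_nonneg (N : ℝ)),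
        mul_le_mul_of_nonneg_left hV (sq_nonneg (N : ℝ))]
    linarith [le_of_mul_le_mul_left hle (by positivity)]
  obtain ⟨i, -, hi⟩ := Finset.exists_le_of_sum_le Finset.univ_nonempty hsum
  refine ⟨i, ?_⟩
  rw [← ENNReal.ofReal_toReal (measure_ne_top (Q.withDensity (L i)) A)]
  refine le_trans (le_of_eq ?_) (ENNReal.ofReal_le_ofReal hi)
  rw [ENNReal.ofReal_div_of_pos (by norm_num)]
  simp

end Mixture

section BlockSignal

variable {p s m : ℕ}

/-- The sign `±1` attached to a Boolean. -/
def boolSign (b : Bool) : ℝ := if b then 1 else -1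

lemma boolSign_ne_zero (b : Bool) : boolSign b ≠ 0 := by cases b <;> norm_num [boolSign]

lemma boolSign_mul_self (b : Bool) : boolSign b * boolSign b = 1 := by
  cases b <;> norm_num [boolSign]

/-- The embedding of `s` disjoint blocks of size `m` into `p` coordinates. -/
def blockIndex (h : s * m ≤ p) (x : Fin s × Fin m) : Fin p := Fin.castLE h (finProdFinEquiv x)

lemma blockIndex_injective (h : s * m ≤ p) : Function.Injective (blockIndex h) :=
  (Fin.castLE_injective h).comp finProdFinEquiv.injective

/-- The vector with exactly one nonzero coordinate, equal to `±ρ`, in each of the blocks. -/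
noncomputable def blockSignal (h : s * m ≤ p) (ρ : ℝ) (J : Fin s → Fin m × Bool) : Fin p → ℝ :=
  ∑ k, Pi.single (blockIndex h (k, (J k).1)) (ρ * boolSign (J k).2)

/-- The contribution of one block to the inner product of two unit block signals. -/
def blockOverlap (x y : Fin m × Bool) : ℝ :=
  if x.1 = y.1 then boolSign x.2 * boolSign y.2 else 0

lemma blockSignal_apply_blockIndex (h : s * m ≤ p) (ρ : ℝ) (J : Fin s → Fin m × Bool)
    (k : Fin s) (j : Fin m) :
    blockSignal h ρ J (blockIndex h (k, j)) = if j = (J k).1 then ρ * boolSign (J k).2 else 0 := by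
  rw [blockSignal, Finset.sum_apply, Finset.sum_eq_single k]
  · simp [Pi.single_apply, (blockIndex_injective h).eq_iff]
  · intro l _ hl
    simp [(blockIndex_injective h).eq_iff, hl.symm]
  · simp

lemma blockSignal_dotProduct (h : s * m ≤ p) (ρ : ℝ) (J J' : Fin s → Fin m × Bool) :
    blockSignal h ρ J ⬝ᵥ blockSignal h ρ J' = ρ ^ 2 * ∑ k, blockOverlap (J k) (J' k) := by
  conv_lhs => rw [blockSignal]
  rw [sum_dotProduct, Finset.mul_sum]
  refine Finset.sum_congr rfl fun k _ => ?_
  rw [single_dotProduct, blockSignal_apply_blockIndex, blockOverlap]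
  split_ifs <;> ring

lemma blockSignal_dotProduct_self (h : s * m ≤ p) (ρ : ℝ) (J : Fin s → Fin m × Bool) :
    blockSignal h ρ J ⬝ᵥ blockSignal h ρ J = s * ρ ^ 2 := by
  rw [blockSignal_dotProduct]
  simp [blockOverlap, boolSign_mul_self, mul_comm]

lemma ncard_support_blockSignal (h : s * m ≤ p) {ρ : ℝ} (hρ : ρ ≠ 0)
    (J : Fin s → Fin m × Bool) : (Function.support (blockSignal h ρ J)).ncard = s := by
  have hsupp : Function.support (blockSignal h ρ J)
      = Set.range fun k => blockIndex h (k, (J k).1) := by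
    ext i
    constructor
    · intro hi
      by_contra hr
      refine hi ?_
      rw [blockSignal, Finset.sum_apply]
      refine Finset.sum_eq_zero fun k _ => Pi.single_eq_of_ne (fun hk => hr ⟨k, hk.symm⟩) _
    · rintro ⟨k, rfl⟩
      simp [blockSignal_apply_blockIndex, hρ, boolSign_ne_zero]
  have hinj : Function.Injective fun k => blockIndex h (k, (J k).1) := fun k l hkl =>
    congrArg Prod.fst (blockIndex_injective h hkl)
  rw [hsupp, ← Set.image_univ, Set.ncard_image_of_injective _ hinj, Set.ncard_univ, Nat.card_fin]

lemma sum_exp_blockOverlap_le (hm : 0 < m) (c : ℝ) (y : Fin m × Bool) :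
    ∑ x, Real.exp (c * blockOverlap x y) ≤ (2 * m) * Real.exp ((Real.cosh c - 1) / m) := by
  have hm0 : (0 : ℝ) < m := by exact_mod_cast hm
  obtain ⟨j, b⟩ := y
  have hsum (i : Fin m) : ∑ e, Real.exp (c * blockOverlap (i, e) (j, b))
      = 2 + if i = j then 2 * Real.cosh c - 2 else 0 := by
    rw [Fintype.sum_bool, Real.cosh_eq]
    by_cases hij : i = j
    · cases b <;> simp [blockOverlap, boolSign, hij] <;> ring
    · norm_num [blockOverlap, hij]
  rw [Fintype.sum_prod_type]
  simp only [hsum]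
  rw [Finset.sum_add_distrib, Finset.sum_ite_eq' Finset.univ j]
  simp only [Finset.sum_const, Finset.card_univ, Fintype.card_fin, nsmul_eq_mul, Finset.mem_univ,
    if_true]
  have hexp := Real.add_one_le_exp ((Real.cosh c - 1) / m)
  calc (m : ℝ) * 2 + (2 * Real.cosh c - 2) = (2 * m) * ((Real.cosh c - 1) / m + 1) := by
        field_simp; ring
    _ ≤ _ := by gcongr

lemma sum_sum_exp_blockOverlap_le (hm : 0 < m) (c : ℝ) :
    ∑ J : Fin s → Fin m × Bool, ∑ J' : Fin s → Fin m × Bool,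
        Real.exp (c * ∑ k, blockOverlap (J k) (J' k))
      ≤ (Fintype.card (Fin s → Fin m × Bool) : ℝ) ^ 2
        * Real.exp (s * ((Real.cosh c - 1) / m)) := by
  have hcard : (Fintype.card (Fin s → Fin m × Bool) : ℝ) = (2 * m) ^ s := by
    simp [mul_comm]
  have hrow (J' : Fin s → Fin m × Bool) :
      ∑ J : Fin s → Fin m × Bool, Real.exp (c * ∑ k, blockOverlap (J k) (J' k))
        ≤ (2 * m) ^ s * Real.exp (s * ((Real.cosh c - 1) / m)) := by
    simp only [Finset.mul_sum, Real.exp_sum]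
    rw [← Fintype.piFinset_univ,
      ← Finset.prod_univ_sum (fun _ => Finset.univ)
        fun k x => Real.exp (c * blockOverlap x (J' k))]
    rw [Real.exp_nat_mul, ← mul_pow]
    refine (Finset.prod_le_prod (fun k _ => Finset.sum_nonneg fun x _ => Real.exp_nonneg _)
      fun k _ => sum_exp_blockOverlap_le hm c (J' k)).trans ?_
    simp
  rw [Finset.sum_comm]
  refine (Finset.sum_le_sum fun J' _ => hrow J').trans (le_of_eq ?_)
  rw [Finset.sum_const, Finset.card_univ, nsmul_eq_mul, hcard]
  ring

end BlockSignal

section Calibration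

lemma cosh_mul_log_sub_one_le {τ M : ℝ} (hτ0 : 0 ≤ τ) (hτ1 : τ ≤ 1) (hM : 0 ≤ M) :
    Real.cosh (τ * Real.log (1 + M)) - 1 ≤ τ * M ^ 2 / (2 * (1 + M)) := by
  have h1 : 0 < 1 + M := by linarith
  have hup := rpow_one_add_le_one_add_mul_self (s := M) (by linarith) hτ0 hτ1
  have hfrac : 1 + -(M / (1 + M)) = (1 + M)⁻¹ := by field_simp; ring
  have hdown := rpow_one_add_le_one_add_mul_self (s := -(M / (1 + M)))
    (by rw [neg_le_neg_iff, div_le_one h1]; linarith) hτ0 hτ1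
  rw [hfrac, Real.inv_rpow h1.le] at hdown
  have hexp : Real.exp (τ * Real.log (1 + M)) = (1 + M) ^ τ := by
    rw [Real.rpow_def_of_pos h1, mul_comm]
  have hid : τ * M ^ 2 / (2 * (1 + M)) = (τ * M + τ * -(M / (1 + M))) / 2 := by
    field_simp; ring
  rw [Real.cosh_eq, Real.exp_neg, hexp, hid]
  linarith

lemma sq_mul_max_sq_le {p s : ℕ} (hs : 0 < s) :
    (s : ℝ) ^ 2 * max ((p : ℝ) / (s : ℝ) ^ 2) (√p / s) ^ 2
      ≤ p * (1 + max ((p : ℝ) / (s : ℝ) ^ 2) (√p / s)) := by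
  have hs0 : (0 : ℝ) < s := by exact_mod_cast hs
  have hp0 : (0 : ℝ) ≤ p := Nat.cast_nonneg p
  rcases le_total ((p : ℝ) / (s : ℝ) ^ 2) (√p / s) with h | h
  · rw [max_eq_right h, div_pow, Real.sq_sqrt hp0, mul_div_cancel₀ _ (by positivity)]
    nlinarith [mul_nonneg hp0 (div_nonneg (Real.sqrt_nonneg p) hs0.le)]
  · rw [max_eq_left h, sq ((p : ℝ) / _), ← mul_assoc, mul_div_cancel₀ _ (by positivity)]
    linarith

lemma blocks_mul_cosh_sub_one_le {p s : ℕ} (hs : 0 < s) (hsp : s ≤ p) {τ : ℝ} (hτ0 : 0 ≤ τ)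
    (hτ1 : τ ≤ 1) :
    s * ((Real.cosh (τ * Real.log (1 + max ((p : ℝ) / (s : ℝ) ^ 2) (√p / s))) - 1)
      / ((p / s : ℕ) : ℝ)) ≤ τ := by
  have hs0 : (0 : ℝ) < s := by exact_mod_cast hs
  have hmax := sq_mul_max_sq_le (p := p) hs
  set M := max ((p : ℝ) / (s : ℝ) ^ 2) (√p / s) with hM
  have hM0 : 0 ≤ M := le_max_of_le_left (by positivity)
  have hm : 0 < p / s := Nat.div_pos hsp hs
  set m := p / s
  have hm0 : (0 : ℝ) < m := by exact_mod_cast hm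
  have hpm : (p : ℝ) ≤ 2 * s * m := by
    have hlt : p < s * (m + 1) := Nat.lt_mul_div_succ p hs
    have hle : s * 1 ≤ s * m := Nat.mul_le_mul_left s hm
    have : p ≤ 2 * s * m := by nlinarith
    exact_mod_cast this
  have hcosh := cosh_mul_log_sub_one_le hτ0 hτ1 hM0
  have hkey : s * M ^ 2 ≤ 2 * m * (1 + M) := by
    have : s * (s * M ^ 2) ≤ s * (2 * m * (1 + M)) := by nlinarith
    exact le_of_mul_le_mul_left this hs0
  calc s * ((Real.cosh (τ * Real.log (1 + M)) - 1) / m)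
      ≤ s * (τ * M ^ 2 / (2 * (1 + M)) / m) := by gcongr
    _ = τ * (s * M ^ 2 / (2 * m * (1 + M))) := by field_simp
    _ ≤ τ * 1 := by
      gcongr
      exact (div_le_one (by positivity)).mpr hkey
    _ = τ := mul_one τ

lemma log_seventeen_div_le : Real.log (17 / (12 * √2)) ≤ 1 / 10 := by
  have h2 : (13 / 10 : ℝ) ≤ √2 := Real.le_sqrt_of_sq_le (by norm_num)
  refine (Real.log_le_sub_one_of_pos (by positivity)).trans ?_
  have : 17 / (12 * √2) ≤ 11 / 10 := by
    rw [div_le_iff₀ (by positivity)]; linarith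
  linarith

lemma exp_le_of_le_twentieth {x : ℝ} (hx : x ≤ 1 / 20) : Real.exp x ≤ 46 / 25 := by
  have hneg := Real.add_one_le_exp (-x)
  rw [Real.exp_neg] at hneg
  have hinv : (25 / 46 : ℝ) ≤ (Real.exp x)⁻¹ := by linarith
  rw [le_inv_comm₀ (by norm_num) (Real.exp_pos x)] at hinv
  norm_num at hinv
  exact hinv

end Calibration

lemma exists_blockSignal_measure_ge {n p s m : ℕ} (h : s * m ≤ p) (hm : 0 < m) {v : NNReal}
    (hv : v ≠ 0) (T : Finset (Fin n)) {ρ b : ℝ} (hρ : s * ρ ^ 2 = b * v) (hb : 4 * b ≤ 1 / 2)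
    (hV : s * ((Real.cosh (T.card * (ρ ^ 2 / v)) - 1) / m) + T.card * (4 * b ^ 2) ≤ 1 / 20)
    {A : Set (Fin n → (Fin p → ℝ) × ℝ)} (hA : MeasurableSet A)
    (hQ : 1 / 2 ≤ (Measure.pi fun _ : Fin n => nullLaw p v).real A) :
    ∃ J : Fin s → Fin m × Bool,
      (1 / 25 : ℝ≥0∞)
        ≤ Measure.pi (fun t => regressionLaw v (signalOn T (blockSignal h ρ J) t)) A := by
  have : NeZero m := ⟨hm.ne'⟩
  have hv0 : (v : ℝ) ≠ 0 := by exact_mod_cast hv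
  set c := T.card * (ρ ^ 2 / v) with hc
  have hprob (J : Fin s → Fin m × Bool) : IsProbabilityMeasure
      ((Measure.pi fun _ : Fin n => nullLaw p v).withDensity
        (jointLikelihoodRatio v T (blockSignal h ρ J))) := by
    rw [← pi_regressionLaw_eq_withDensity hv]; infer_instance
  have hpair (J J' : Fin s → Fin m × Bool) :
      ∫⁻ ω, jointLikelihoodRatio v T (blockSignal h ρ J) ω
          * jointLikelihoodRatio v T (blockSignal h ρ J') ω
          ∂Measure.pi (fun _ : Fin n => nullLaw p v)
        ≤ ENNReal.ofReal (Real.exp (c * ∑ k, blockOverlap (J k) (J' k))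
            * Real.exp (T.card * (4 * b ^ 2))) := by
    refine (lintegral_jointLikelihoodRatio_mul_le hv T (b := b)
      (a := ρ ^ 2 / v * ∑ k, blockOverlap (J k) (J' k)) ?_ ?_ ?_ hb).trans (le_of_eq ?_)
    · rw [blockSignal_dotProduct_self, hρ]
    · rw [blockSignal_dotProduct_self, hρ]
    · rw [blockSignal_dotProduct]; field_simp
    · rw [← Real.exp_add, hc]; congr 2; ring
  simp only [pi_regressionLaw_eq_withDensity hv]
  refine exists_withDensity_ge _ (fun J => measurable_jointLikelihoodRatio v T _) hA hQ
    (V := Real.exp (s * ((Real.cosh c - 1) / m)) * Real.exp (T.card * (4 * b ^ 2)))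
    (by positivity) (by rw [← Real.exp_add]; exact exp_le_of_le_twentieth hV) ?_
  refine (Finset.sum_le_sum fun J _ => Finset.sum_le_sum fun J' _ => hpair J J').trans ?_
  simp only [← ENNReal.ofReal_sum_of_nonneg (fun _ _ => mul_nonneg (Real.exp_nonneg _)
    (Real.exp_nonneg _))]
  rw [← ENNReal.ofReal_sum_of_nonneg fun _ _ => Finset.sum_nonneg fun _ _ => by positivity]
  refine ENNReal.ofReal_le_ofReal ?_
  simp only [← Finset.sum_mul]
  rw [← mul_assoc (_ ^ 2)]
  exact mul_le_mul_of_nonneg_right (sum_sum_exp_blockOverlap_le hm c) (Real.exp_nonneg _)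

lemma l2norm_eq_sqrt_dotProduct {p : ℕ} (v : Fin p → ℝ) : l2norm v = √(v ⬝ᵥ v) := by
  simp only [l2norm, dotProduct, sq]

/-- Minimax detection lower bound in the isotropic case (Theorem 1(i)).
Under the stated conditions on `n, p, 𝔰, Δ, σ, τ`, for every measurable estimator `θ̂`
there exist a change point `θ ∈ {1,…,n}` with `min(θ, n−θ) = Δ` and parameters
`β₀, β₁ ∈ ℝ^p` such that `δ = β₁ − β₀` has exactly `𝔰` nonzero coordinates,
`‖δ‖₂²·Δ ≥ τ·Ψ²·𝔰·log(1 + max(p/𝔰², √p/𝔰))` with `Ψ = max(‖β₀‖₂, ‖β₁‖₂, σ)`, and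
`P_{θ,β₀,β₁}(|θ̂ − θ| ≥ Δ) ≥ 1/25` (here `Σ = I_p`, i.e. `Σ^{1/2} = 1`). -/
theorem minimax_detection_lower_bound_isotropic
    (n p s Δ : ℕ) (hn : 0 < n) (hp : 0 < p) (hs1 : 1 ≤ s) (hsp : s ≤ p)
    (hΔ1 : 1 ≤ Δ) (hΔn : 4 * Δ ≤ n) (σ τ : ℝ) (hσ : 0 < σ) (hτ : 0 < τ)
    (hsparse : (s : ℝ) * Real.log (1 + max ((p : ℝ) / (s : ℝ) ^ 2) (Real.sqrt p / s))
      ≤ Real.sqrt ((25 / 2) * Real.log (17 / (12 * Real.sqrt 2)) * Δ))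
    (hτle : τ ≤ (2 / 5) * Real.log (17 / (12 * Real.sqrt 2)))
    (θhat : (Fin n → (Fin p → ℝ) × ℝ) → ℝ) (hθhat : Measurable θhat) :
    ∃ θ : ℕ, 1 ≤ θ ∧ θ ≤ n ∧ min θ (n - θ) = Δ ∧
      ∃ β₀ β₁ : Fin p → ℝ,
        (Function.support (β₁ - β₀)).ncard = s ∧
        τ * max (max (l2norm β₀) (l2norm β₁)) σ ^ 2 * s *
            Real.log (1 + max ((p : ℝ) / (s : ℝ) ^ 2) (Real.sqrt p / s))
          ≤ l2norm (β₁ - β₀) ^ 2 * Δ ∧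
        (1 / 25 : ℝ≥0∞) ≤
          amocLaw n p 1 β₀ β₁ σ θ {ω | (Δ : ℝ) ≤ |θhat ω - θ|} := by
  have hs0 : (0 : ℝ) < s := by exact_mod_cast hs1
  have hΔ0 : (0 : ℝ) < Δ := by exact_mod_cast hΔ1
  have hΔ1' : (1 : ℝ) ≤ Δ := by exact_mod_cast hΔ1
  have hp0 : (0 : ℝ) < p := by exact_mod_cast hp
  have hτ25 : τ ≤ 1 / 25 := by linarith [log_seventeen_div_le]
  have hcal := blocks_mul_cosh_sub_one_le hs1 hsp hτ.le (by linarith)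
  have hM0 : 0 < max ((p : ℝ) / (s : ℝ) ^ 2) (√p / s) := lt_max_of_lt_left (by positivity)
  have hℓ0 : 0 < Real.log (1 + max ((p : ℝ) / (s : ℝ) ^ 2) (√p / s)) :=
    Real.log_pos (by linarith)
  set ℓ := Real.log (1 + max ((p : ℝ) / (s : ℝ) ^ 2) (√p / s))
  have hsparse_sq : (s * ℓ) ^ 2 ≤ 5 / 4 * Δ := by
    refine ((Real.le_sqrt' (by positivity)).mp hsparse).trans ?_
    nlinarith [mul_le_mul_of_nonneg_right log_seventeen_div_le hΔ0.le]
  set v := (σ ^ 2).toNNReal with hvdef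
  have hvσ : (v : ℝ) = σ ^ 2 := Real.coe_toNNReal _ (sq_nonneg σ)
  have hv0 : (0 : ℝ) < v := by rw [hvσ]; positivity
  have hv : v ≠ 0 := by exact_mod_cast hv0.ne'
  set ρ := √(τ * v * ℓ / Δ) with hρdef
  have hρsq : ρ ^ 2 = τ * v * ℓ / Δ := Real.sq_sqrt (by positivity)
  have hρ0 : ρ ≠ 0 := (Real.sqrt_pos.mpr (by positivity)).ne'
  set b := τ * (s * ℓ) / Δ with hbdef
  have hb0 : 0 ≤ b := by positivity
  have hρb : s * ρ ^ 2 = b * v := by rw [hρsq, hbdef]; ring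
  have hbsq : Δ * b ^ 2 ≤ 1 / 500 := by
    have hval : Δ * b ^ 2 = τ ^ 2 * ((s * ℓ) ^ 2 / Δ) := by rw [hbdef]; field_simp
    have hdiv : (s * ℓ) ^ 2 / Δ ≤ 5 / 4 := (div_le_iff₀ hΔ0).mpr hsparse_sq
    have hτsq : τ ^ 2 ≤ 1 / 625 := by nlinarith
    rw [hval]
    calc τ ^ 2 * ((s * ℓ) ^ 2 / Δ) ≤ 1 / 625 * (5 / 4) := by gcongr
      _ = 1 / 500 := by norm_num
  have hb : b ≤ 1 / 8 := by
    have : b ^ 2 ≤ Δ * b ^ 2 := le_mul_of_one_le_left (sq_nonneg b) hΔ1'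
    nlinarith
  have hblocks : s * (p / s) ≤ p := Nat.mul_div_le p s
  have hm : 0 < p / s := Nat.div_pos hsp hs1
  have hdetect (T : Finset (Fin n)) (hT : T.card = Δ) {A : Set (Fin n → (Fin p → ℝ) × ℝ)}
      (hA : MeasurableSet A) (hQ : 1 / 2 ≤ (Measure.pi fun _ : Fin n => nullLaw p v).real A) :=
    exists_blockSignal_measure_ge hblocks hm hv T hρb (by linarith)
      (by
        have hc : (Δ : ℝ) * (ρ ^ 2 / v) = τ * ℓ := by rw [hρsq]; field_simp
        rw [hT, hc]; linarith) hA hQ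
  have hnorm (J : Fin s → Fin (p / s) × Bool) : l2norm (blockSignal hblocks ρ J) ^ 2 = b * v := by
    rw [l2norm_eq_sqrt_dotProduct, blockSignal_dotProduct_self, hρb, Real.sq_sqrt (by positivity)]
  have hnorm_le (J : Fin s → Fin (p / s) × Bool) : l2norm (blockSignal hblocks ρ J) ≤ σ := by
    refine le_of_sq_le_sq ?_ hσ.le
    rw [hnorm, ← hvσ]; nlinarith
  have hzero : l2norm (0 : Fin p → ℝ) = 0 := by simp [l2norm]
  have hsignal : τ * σ ^ 2 * s * ℓ ≤ b * v * Δ := by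
    rw [hbdef, hvσ]; exact le_of_eq (by field_simp)
  set A : ℕ → Set (Fin n → (Fin p → ℝ) × ℝ) := fun θ => {ω | (Δ : ℝ) ≤ |θhat ω - θ|} with hAdef
  have hA (θ : ℕ) : MeasurableSet (A θ) :=
    measurableSet_le measurable_const (by fun_prop)
  have hcover : A Δ ∪ A (n - Δ) = Set.univ := by
    refine Set.eq_univ_of_forall fun ω => ?_
    by_contra hω
    simp only [hAdef, Set.mem_union, Set.mem_ofPred_eq, not_or, not_le, abs_lt,
      Nat.cast_sub (show Δ ≤ n by omega)] at hω
    have hΔn' : 4 * (Δ : ℝ) ≤ n := by exact_mod_cast hΔn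
    linarith [hω.1.2, hω.2.1]
  have hhalf : 1 / 2 ≤ (Measure.pi fun _ : Fin n => nullLaw p v).real (A Δ)
      ∨ 1 / 2 ≤ (Measure.pi fun _ : Fin n => nullLaw p v).real (A (n - Δ)) := by
    by_contra! hlt
    have hunion := measureReal_union_le (μ := Measure.pi fun _ : Fin n => nullLaw p v)
      (A Δ) (A (n - Δ))
    rw [hcover, probReal_univ] at hunion
    linarith [hlt.1, hlt.2]
  rcases hhalf with hQ | hQ
  · obtain ⟨J, hJ⟩ := hdetect (Finset.univ.filter fun t : Fin n => (t : ℕ) < Δ)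
      (by rw [Fin.card_filter_val_lt]; omega) (hA Δ) hQ
    refine ⟨Δ, hΔ1, by omega, by omega, blockSignal hblocks ρ J, 0, ?_, ?_, ?_⟩
    · rw [zero_sub, Function.support_neg, ncard_support_blockSignal _ hρ0]
    · have hneg : l2norm (0 - blockSignal hblocks ρ J) = l2norm (blockSignal hblocks ρ J) := by
        simp [l2norm]
      rw [hneg, hnorm, hzero, max_eq_right (max_le (hnorm_le J) hσ.le)]
      exact hsignal
    · rw [amocLaw_one_eq_pi]
      simpa only [signalOn, Finset.mem_filter, Finset.mem_univ, true_and] using hJ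
  · obtain ⟨J, hJ⟩ := hdetect (Finset.univ.filter fun t : Fin n => ¬ (t : ℕ) < n - Δ)
      (by
        have hsplit := Finset.card_filter_add_card_filter_not (s := (Finset.univ : Finset (Fin n)))
          (fun t : Fin n => (t : ℕ) < n - Δ)
        rw [Fin.card_filter_val_lt, Finset.card_univ, Fintype.card_fin] at hsplit
        omega) (hA (n - Δ)) hQ
    refine ⟨n - Δ, by omega, by omega, by omega, 0, blockSignal hblocks ρ J, ?_, ?_, ?_⟩
    · rw [sub_zero, ncard_support_blockSignal _ hρ0]
    · rw [sub_zero, hnorm, hzero, max_eq_right (max_le hσ.le (hnorm_le J))]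
      exact hsignal
    · rw [amocLaw_one_eq_pi]
      simpa only [signalOn, Finset.mem_filter, Finset.mem_univ, true_and, ite_not] using hJ
end

section
/- Chi-square affinity for a pair of Gaussian single-index regression models (Lemma B.2). Let p ≥ 1 be an integer, σ > 0, κ ≥ 0 with κ < σ/√2, and let u, v ∈ ℝ^p satisfy ‖u‖₂ = ‖v‖₂ = κ. Let γ_p denote the standard Gaussian measure on ℝ^p and ν the centered Gaussian measure on ℝ with variance σ². Then ∫_{ℝ^p × ℝ} exp( (2y·⟨u + v, x⟩ − ⟨u, x⟩² − ⟨v, x⟩²) / (2σ²) ) d(γ_p ⊗ ν)(x, y) = ( (1 − ⟨u, v⟩/σ²)² − (κ²/σ²)² )^{−1/2}. -/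
open MeasureTheory ProbabilityTheory

/-- The exponential moment of the square of a centered Gaussian variable. -/
lemma integral_exp_mul_sq_gaussianReal (v : NNReal) {t : ℝ} (ht : 2 * t * v < 1) :
    ∫ x, Real.exp (t * x ^ 2) ∂(gaussianReal 0 v) = (1 - 2 * t * v) ^ (-(1 / 2 : ℝ)) := by
  rcases eq_or_ne v 0 with rfl | hv
  · simp
  have hv' : (0 : ℝ) < v := by positivity
  have h1 : 0 < 1 - 2 * t * v := by linarith
  have hpdf (x : ℝ) : gaussianPDFReal 0 v x • Real.exp (t * x ^ 2)
      = (√(2 * Real.pi * v))⁻¹ * Real.exp (-((1 - 2 * t * v) / (2 * v)) * x ^ 2) := by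
    rw [gaussianPDFReal, smul_eq_mul, mul_assoc, ← Real.exp_add]
    congr 2
    field_simp
    ring
  simp_rw [integral_gaussianReal_eq_integral_smul hv, hpdf]
  rw [integral_const_mul, integral_gaussian, Real.rpow_neg h1.le, ← Real.sqrt_eq_rpow,
    ← Real.sqrt_inv, ← Real.sqrt_inv, ← Real.sqrt_mul (by positivity)]
  congr 1
  field_simp

/-- Integrating out the noise variable against a linear exponential tilt. -/
lemma integral_prod_exp_linear_gaussianReal {α : Type*} [MeasurableSpace α] (μ : Measure α)
    [SFinite μ] {f g : α → ℝ} (hf : Measurable f) (hg : Measurable g) (v : NNReal) :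
    ∫ q : α × ℝ, Real.exp (f q.1 * q.2 + g q.1) ∂(μ.prod (gaussianReal 0 v))
      = ∫ x, Real.exp (v * f x ^ 2 / 2 + g x) ∂μ := by
  have hinner (x : α) : ∫⁻ y, ENNReal.ofReal (Real.exp (f x * y + g x)) ∂(gaussianReal 0 v)
      = ENNReal.ofReal (Real.exp (v * f x ^ 2 / 2 + g x)) := by
    have hmgf := congrFun (mgf_fun_id_gaussianReal (μ := 0) (v := v)) (f x)
    rw [mgf] at hmgf
    simp_rw [Real.exp_add]
    rw [← ofReal_integral_eq_lintegral_ofReal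
      ((integrable_exp_mul_gaussianReal (f x)).mul_const _)
      (ae_of_all _ fun y => by positivity), integral_mul_const, hmgf]
    simp
  rw [integral_eq_lintegral_of_nonneg_ae (ae_of_all _ fun q => (Real.exp_pos _).le)
      (by fun_prop), integral_eq_lintegral_of_nonneg_ae
      (ae_of_all _ fun q => (Real.exp_pos _).le) (by fun_prop),
    lintegral_prod _ (by fun_prop)]
  simp_rw [hinner]

instance (p : ℕ) : IsProbabilityMeasure (stdGaussianVec p) := by
  unfold stdGaussianVec; infer_instance

lemma map_eval_stdGaussianVec {p : ℕ} (i : Fin p) :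
    (stdGaussianVec p).map (fun x => x i) = gaussianReal 0 1 :=
  (measurePreserving_eval _ i).map_eq

lemma hasGaussianLaw_id_stdGaussianVec (p : ℕ) :
    HasGaussianLaw (fun x : Fin p → ℝ => x) (stdGaussianVec p) := by
  refine iIndepFun.hasGaussianLaw (X := fun i (x : Fin p → ℝ) => x i) (fun i => ?_) ?_
  · refine ⟨?_⟩
    rw [map_eval_stdGaussianVec]
    infer_instance
  · exact iIndepFun_pi (X := fun _ x => x) fun _ => aemeasurable_id

lemma hasGaussianLaw_linear_pair_stdGaussianVec {p : ℕ} (a b : Fin p → ℝ) :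
    HasGaussianLaw (fun x : Fin p → ℝ => (∑ i, a i * x i, ∑ i, b i * x i))
      (stdGaussianVec p) := by
  convert! (hasGaussianLaw_id_stdGaussianVec p).map_fun
    ((∑ i, a i • ContinuousLinearMap.proj (R := ℝ) (φ := fun _ : Fin p => ℝ) i).prod
      (∑ i, b i • ContinuousLinearMap.proj (R := ℝ) (φ := fun _ : Fin p => ℝ) i)) using 2
  simp

lemma memLp_two_eval_stdGaussianVec {p : ℕ} (i : Fin p) :
    MemLp (fun x : Fin p → ℝ => x i) 2 (stdGaussianVec p) :=
  (HasGaussianLaw.eval (X := fun i (x : Fin p → ℝ) => x i)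
    (hasGaussianLaw_id_stdGaussianVec p) i).memLp_two

lemma integral_eval_stdGaussianVec {p : ℕ} (i : Fin p) :
    ∫ x, x i ∂(stdGaussianVec p) = 0 := by
  have h := integral_map (measurable_pi_apply i).aemeasurable
    (μ := stdGaussianVec p) (f := fun y : ℝ => y) (by fun_prop)
  rw [← h, map_eval_stdGaussianVec, integral_id_gaussianReal]

lemma covariance_eval_stdGaussianVec {p : ℕ} (i j : Fin p) :
    cov[fun x => x i, fun x => x j; stdGaussianVec p] = if i = j then 1 else 0 := by
  split_ifs with h
  · subst h
    rw [covariance_self (measurable_pi_apply i).aemeasurable,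
      ← variance_id_map (measurable_pi_apply i).aemeasurable, map_eval_stdGaussianVec]
    simp
  · have hind : iIndepFun (fun i (x : Fin p → ℝ) => x i) (stdGaussianVec p) :=
      iIndepFun_pi (X := fun _ x => x) fun _ => aemeasurable_id
    exact (hind.indepFun h).covariance_eq_zero (memLp_two_eval_stdGaussianVec i)
      (memLp_two_eval_stdGaussianVec j)

lemma covariance_linear_stdGaussianVec {p : ℕ} (a b : Fin p → ℝ) :
    cov[fun x => ∑ i, a i * x i, fun x => ∑ i, b i * x i; stdGaussianVec p]
      = ∑ i, a i * b i := by
  rw [covariance_fun_sum_fun_sum (fun i => (memLp_two_eval_stdGaussianVec i).const_mul _)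
    (fun i => (memLp_two_eval_stdGaussianVec i).const_mul _)]
  simp [covariance_const_mul_left, covariance_const_mul_right, covariance_eval_stdGaussianVec,
    mul_comm]

lemma map_linear_stdGaussianVec {p : ℕ} (a : Fin p → ℝ) :
    (stdGaussianVec p).map (fun x => ∑ i, a i * x i)
      = gaussianReal 0 (Real.toNNReal (∑ i, a i ^ 2)) := by
  rw [(hasGaussianLaw_linear_pair_stdGaussianVec a a).fst.map_eq_gaussianReal,
    ← covariance_self (Measurable.aemeasurable (by fun_prop)), covariance_linear_stdGaussianVec,
    integral_finsetSum _ fun i _ =>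
      ((memLp_two_eval_stdGaussianVec i).integrable one_le_two).const_mul _]
  simp [integral_const_mul, integral_eval_stdGaussianVec, sq]

lemma integral_exp_mul_sq_linear_stdGaussianVec {p : ℕ} (a : Fin p → ℝ) {t : ℝ}
    (ht : 2 * t * ∑ i, a i ^ 2 < 1) :
    ∫ x, Real.exp (t * (∑ i, a i * x i) ^ 2) ∂(stdGaussianVec p)
      = (1 - 2 * t * ∑ i, a i ^ 2) ^ (-(1 / 2 : ℝ)) := by
  have hnn : ((Real.toNNReal (∑ i, a i ^ 2) : NNReal) : ℝ) = ∑ i, a i ^ 2 :=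
    Real.coe_toNNReal _ (by positivity)
  have h := integral_exp_mul_sq_gaussianReal (Real.toNNReal (∑ i, a i ^ 2)) (t := t)
    (by rwa [hnn])
  rwa [hnn, ← map_linear_stdGaussianVec, integral_map (Measurable.aemeasurable (by fun_prop))
    (by fun_prop)] at h

/-- Chi-square affinity for a pair of Gaussian single-index regression models (Lemma B.2):
for `u, v ∈ ℝ^p` with `‖u‖₂ = ‖v‖₂ = κ < σ/√2`,
`∫ exp((2y⟨u+v,x⟩ − ⟨u,x⟩² − ⟨v,x⟩²)/(2σ²)) d(γ_p ⊗ ν)(x,y)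
  = ((1 − ⟨u,v⟩/σ²)² − (κ²/σ²)²)^{−1/2}`,
where `γ_p` is the standard Gaussian measure on `ℝ^p` and `ν = N(0, σ²)`. -/
theorem chi_square_affinity (p : ℕ) (σ κ : ℝ) (hσ : 0 < σ) (hκ0 : 0 ≤ κ)
    (hκ : κ < σ / Real.sqrt 2) (u v : Fin p → ℝ)
    (hu : l2norm u = κ) (hv : l2norm v = κ) :
    (∫ q : (Fin p → ℝ) × ℝ,
        Real.exp ((2 * q.2 * (∑ i, (u i + v i) * q.1 i)
            - (∑ i, u i * q.1 i) ^ 2 - (∑ i, v i * q.1 i) ^ 2) / (2 * σ ^ 2))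
      ∂((stdGaussianVec p).prod (gaussianReal 0 (Real.toNNReal (σ ^ 2)))))
      = ((1 - (∑ i, u i * v i) / σ ^ 2) ^ 2 - (κ ^ 2 / σ ^ 2) ^ 2) ^ (-(1 / 2 : ℝ)) := by
  have hvar {w : Fin p → ℝ} (hw : l2norm w = κ) : ∑ i, w i ^ 2 = κ ^ 2 := by
    rw [← hw, l2norm, Real.sq_sqrt (by positivity)]
  have hu2 := hvar hu
  have hv2 := hvar hv
  have hσ2 : 0 < σ ^ 2 := by positivity
  have hκσ : 2 * κ ^ 2 < σ ^ 2 := by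
    rw [lt_div_iff₀ (by positivity)] at hκ
    have h := pow_lt_pow_left₀ hκ (by positivity) two_ne_zero
    rw [mul_pow, Real.sq_sqrt zero_le_two] at h
    linarith
  set ρ := ∑ i, u i * v i with hρ
  have hadd : ∑ i, (u i + v i) ^ 2 = 2 * κ ^ 2 + 2 * ρ := by
    simp_rw [add_sq, Finset.sum_add_distrib, mul_assoc, ← Finset.mul_sum, hu2, hv2, ← hρ]
    ring
  have hsub : ∑ i, (u i - v i) ^ 2 = 2 * κ ^ 2 - 2 * ρ := by
    simp_rw [sub_sq, Finset.sum_add_distrib, Finset.sum_sub_distrib, mul_assoc,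
      ← Finset.mul_sum, hu2, hv2, ← hρ]
    ring
  have horth : ∑ i, (u i + v i) * (u i - v i) = 0 := by
    simp_rw [← sq_sub_sq, Finset.sum_sub_distrib, hu2, hv2, sub_self]
  have hsub0 : 0 ≤ ∑ i, (u i - v i) ^ 2 := by positivity
  have hplus : 2 * (1 / (4 * σ ^ 2)) * ∑ i, (u i + v i) ^ 2 < 1 := by
    rw [← mul_div_assoc, div_mul_eq_mul_div, div_lt_one (by positivity)]
    linarith
  have hminus : 2 * (-(1 / (4 * σ ^ 2))) * ∑ i, (u i - v i) ^ 2 < 1 := by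
    have : 0 ≤ 1 / (4 * σ ^ 2) * ∑ i, (u i - v i) ^ 2 := by positivity
    linarith
  have hind := (hasGaussianLaw_linear_pair_stdGaussianVec (fun i => u i + v i)
    (fun i => u i - v i)).indepFun_of_covariance_eq_zero
    ((covariance_linear_stdGaussianVec _ _).trans horth)
  have hsplit := hind.integral_fun_comp_mul_comp
    (f := fun s => Real.exp (1 / (4 * σ ^ 2) * s ^ 2))
    (g := fun s => Real.exp (-(1 / (4 * σ ^ 2)) * s ^ 2))
    (Measurable.aemeasurable (by fun_prop)) (Measurable.aemeasurable (by fun_prop))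
    (by fun_prop) (by fun_prop)
  rw [integral_exp_mul_sq_linear_stdGaussianVec _ hplus,
    integral_exp_mul_sq_linear_stdGaussianVec _ hminus,
    ← Real.mul_rpow (by linarith) (by linarith), hadd, hsub] at hsplit
  have hnoise := integral_prod_exp_linear_gaussianReal (stdGaussianVec p)
    (f := fun x => (∑ i, (u i + v i) * x i) / σ ^ 2)
    (g := fun x => -((∑ i, u i * x i) ^ 2 + (∑ i, v i * x i) ^ 2) / (2 * σ ^ 2))
    (by fun_prop) (by fun_prop) (Real.toNNReal (σ ^ 2))
  rw [Real.coe_toNNReal _ hσ2.le] at hnoise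
  calc
    _ = _ := by
      refine Eq.trans (integral_congr_ae (ae_of_all _ fun q => ?_)) hnoise
      simp only
      congr 1
      field_simp
      ring
    _ = _ := by
      refine Eq.trans (integral_congr_ae (ae_of_all _ fun x => ?_)) hsplit
      simp only [← Real.exp_add, add_mul, sub_mul, Finset.sum_add_distrib,
        Finset.sum_sub_distrib]
      congr 1
      field_simp
      ring
    _ = _ := by
      congr 1
      field_simp
      ring
end

section
/- Separation of the drift of the covariance-scanning statistic, left case (Lemma B.2'/lem:f:bar, first part). Let n, m, k, θ be integers with 1 ≤ m ≤ k ≤ θ ≤ n and k ≤ n − 1, let Σ be a p×p real matrix and δ ∈ ℝ^p. Then ‖f̄_k‖_∞ − ‖f̄_m‖_∞ = ‖f̄_k − f̄_m‖_∞ ≥ ( 3·(k−m)·(n−θ)·(k+n−m) ) / ( 8·√(n·k·(n−k))·(n−m) ) · ‖Σδ‖_∞. -/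
open Matrix

/-- The drift of the covariance-scanning statistic:
`f̄_j = √(j(n−j)/n) · ( (n−θ)/(n−j)·𝟙{j ≤ θ} + (θ/j)·𝟙{j > θ} ) · Σδ ∈ ℝ^p`. -/
noncomputable def fbar {p : ℕ} (n θ : ℕ) (S : Matrix (Fin p) (Fin p) ℝ) (δ : Fin p → ℝ)
    (j : ℕ) : Fin p → ℝ :=
  (Real.sqrt ((j : ℝ) * ((n : ℝ) - j) / n) *
      (if j ≤ θ then ((n : ℝ) - θ) / ((n : ℝ) - j) else (θ : ℝ) / j)) • S.mulVec δ

/-- The scalar coefficient of the drift to the left of the change point, up to the factor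
`n - θ`. -/
noncomputable def leftDriftCoeff (n x : ℝ) : ℝ :=
  Real.sqrt (x * (n - x) / n) / (n - x)

lemma leftDriftCoeff_nonneg {n x : ℝ} (hx : x < n) : 0 ≤ leftDriftCoeff n x :=
  div_nonneg (Real.sqrt_nonneg _) (sub_nonneg.2 hx.le)

lemma leftDriftCoeff_sq {n x : ℝ} (hx₀ : 0 < x) (hx : x < n) :
    leftDriftCoeff n x ^ 2 = x / (n * (n - x)) := by
  have hnx : 0 < n - x := sub_pos.2 hx
  have hn : 0 < n := hx₀.trans hx
  rw [leftDriftCoeff, div_pow, Real.sq_sqrt (by positivity)]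
  field_simp

lemma sqrt_eq_leftDriftCoeff_mul {n x : ℝ} (hx₀ : 0 < x) (hx : x < n) :
    Real.sqrt (n * x * (n - x)) = leftDriftCoeff n x * n * (n - x) := by
  have hnx : 0 < n - x := sub_pos.2 hx
  have hn : 0 < n := hx₀.trans hx
  have hA := leftDriftCoeff_nonneg hx
  rw [Real.sqrt_eq_iff_mul_self_eq (by positivity) (by positivity)]
  symm
  calc leftDriftCoeff n x * n * (n - x) * (leftDriftCoeff n x * n * (n - x))
      = leftDriftCoeff n x ^ 2 * (n * (n - x)) ^ 2 := by ring
    _ = n * x * (n - x) := by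
      rw [leftDriftCoeff_sq hx₀ hx]
      field_simp

lemma leftDriftCoeff_mul_le {n x y : ℝ} (hx₀ : 0 < x) (hxy : x ≤ y) (hy : y < n) :
    leftDriftCoeff n x * (n + (y - x)) ≤ leftDriftCoeff n y * (n - (y - x)) := by
  have hy₀ : 0 < y := hx₀.trans_le hxy
  have hx : x < n := hxy.trans_lt hy
  have hny : 0 < n - y := sub_pos.2 hy
  have hnx : 0 < n - x := sub_pos.2 hx
  have hn : 0 < n := hy₀.trans hy
  have hA := leftDriftCoeff_nonneg hy
  refine le_of_sq_le_sq ?_ (mul_nonneg hA (by linarith))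
  rw [mul_pow, mul_pow, leftDriftCoeff_sq hx₀ hx, leftDriftCoeff_sq hy₀ hy, div_mul_eq_mul_div,
    div_mul_eq_mul_div, div_le_div_iff₀ (by positivity) (by positivity)]
  have h : 0 ≤ n * ((y - x) * n * (x - (n - y)) ^ 2) :=
    mul_nonneg hn.le (mul_nonneg (mul_nonneg (sub_nonneg.2 hxy) hn.le) (sq_nonneg _))
  linarith

lemma leftDriftCoeff_mono {n x y : ℝ} (hx₀ : 0 < x) (hxy : x ≤ y) (hy : y < n) :
    leftDriftCoeff n x ≤ leftDriftCoeff n y := by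
  have hn : 0 < n := (hx₀.trans_le hxy).trans hy
  have hA := leftDriftCoeff_nonneg hy
  have hB := leftDriftCoeff_nonneg (hxy.trans_lt hy)
  have h := leftDriftCoeff_mul_le hx₀ hxy hy
  refine le_of_mul_le_mul_right ?_ hn
  nlinarith [mul_nonneg hA (sub_nonneg.2 hxy), mul_nonneg hB (sub_nonneg.2 hxy)]

lemma leftDriftCoeff_separation {n x y : ℝ} (hx₀ : 0 < x) (hxy : x ≤ y) (hy : y < n) :
    3 * (y - x) * (y + n - x) / (8 * Real.sqrt (n * y * (n - y)) * (n - x)) ≤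
      leftDriftCoeff n y - leftDriftCoeff n x := by
  have hy₀ : 0 < y := hx₀.trans_le hxy
  have hx : x < n := hxy.trans_lt hy
  have hny : 0 < n - y := sub_pos.2 hy
  have hnx : 0 < n - x := sub_pos.2 hx
  have hn : 0 < n := hy₀.trans hy
  have hs : 0 < Real.sqrt (n * y * (n - y)) := by positivity
  have hA := leftDriftCoeff_nonneg hy
  have hAB := leftDriftCoeff_mono hx₀ hxy hy
  have hmul := leftDriftCoeff_mul_le hx₀ hxy hy
  have hsq : (leftDriftCoeff n y ^ 2 - leftDriftCoeff n x ^ 2) * ((n - y) * (n - x)) = y - x := by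
    rw [leftDriftCoeff_sq hx₀ hx, leftDriftCoeff_sq hy₀ hy]
    field_simp
    ring
  rw [div_le_iff₀ (by positivity), sqrt_eq_leftDriftCoeff_mul hy₀ hy]
  set A := leftDriftCoeff n y
  set B := leftDriftCoeff n x
  have hkey : 0 ≤ 8 * A * n - 3 * (A + B) * (y + n - x) := by
    nlinarith [mul_nonneg hA hn.le]
  have h : 0 ≤ (A - B) * (8 * A * n - 3 * (A + B) * (y + n - x)) * ((n - y) * (n - x)) :=
    mul_nonneg (mul_nonneg (sub_nonneg.2 hAB) hkey) (mul_pos hny hnx).le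
  calc 3 * (y - x) * (y + n - x)
      = 3 * ((A ^ 2 - B ^ 2) * ((n - y) * (n - x))) * (y + n - x) := by rw [hsq]
    _ ≤ (A - B) * (8 * (A * n * (n - y)) * (n - x)) := by linarith

lemma fbar_of_le {p n θ j : ℕ} (hj : j ≤ θ) (S : Matrix (Fin p) (Fin p) ℝ) (δ : Fin p → ℝ) :
    fbar n θ S δ j = (((n : ℝ) - θ) * leftDriftCoeff n j) • S.mulVec δ := by
  rw [fbar, if_pos hj, leftDriftCoeff]
  congr 1
  ring

/-- Separation of the drift of the covariance-scanning statistic, left case: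
for `1 ≤ m ≤ k ≤ θ ≤ n`, `k ≤ n − 1`,
`‖f̄_k‖∞ − ‖f̄_m‖∞ = ‖f̄_k − f̄_m‖∞ ≥ 3(k−m)(n−θ)(k+n−m)/(8√(nk(n−k))(n−m)) · ‖Σδ‖∞`,
where `‖·‖` denotes the coordinatewise maximum absolute value (the sup norm on `ℝ^p`). -/
theorem fbar_separation_left (p n m k θ : ℕ) (hm : 1 ≤ m) (hmk : m ≤ k) (hkθ : k ≤ θ)
    (hθn : θ ≤ n) (hk : k ≤ n - 1) (S : Matrix (Fin p) (Fin p) ℝ) (δ : Fin p → ℝ) :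
    ‖fbar n θ S δ k‖ - ‖fbar n θ S δ m‖ = ‖fbar n θ S δ k - fbar n θ S δ m‖ ∧
      3 * ((k : ℝ) - m) * ((n : ℝ) - θ) * ((k : ℝ) + n - m) /
          (8 * Real.sqrt ((n : ℝ) * k * ((n : ℝ) - k)) * ((n : ℝ) - m)) * ‖S.mulVec δ‖
        ≤ ‖fbar n θ S δ k - fbar n θ S δ m‖ := by
  have hn : k < n := by omega
  have hm₀ : (0 : ℝ) < m := by exact_mod_cast hm
  have hmk' : (m : ℝ) ≤ k := by exact_mod_cast hmk
  have hkn : (k : ℝ) < n := by exact_mod_cast hn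
  have hθ : 0 ≤ (n : ℝ) - θ := sub_nonneg.2 (by exact_mod_cast hθn)
  have hB := leftDriftCoeff_nonneg (hmk'.trans_lt hkn)
  have hA := leftDriftCoeff_nonneg hkn
  have hAB := leftDriftCoeff_mono hm₀ hmk' hkn
  have hsep := leftDriftCoeff_separation hm₀ hmk' hkn
  rw [fbar_of_le hkθ, fbar_of_le (hmk.trans hkθ), ← sub_smul, ← mul_sub, norm_smul, norm_smul,
    norm_smul, Real.norm_of_nonneg (mul_nonneg hθ hA), Real.norm_of_nonneg (mul_nonneg hθ hB),
    Real.norm_of_nonneg (mul_nonneg hθ (sub_nonneg.2 hAB))]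
  refine ⟨by ring, mul_le_mul_of_nonneg_right ?_ (norm_nonneg _)⟩
  refine le_of_eq_of_le ?_ (mul_le_mul_of_nonneg_left hsep hθ)
  ring
end

section
/- Separation of the drift of the covariance-scanning statistic, right case (Lemma B.2'/lem:f:bar, second part). Let n, m, k, θ be integers with 1 ≤ θ ≤ k ≤ m ≤ n and k ≤ n − 1, let Σ be a p×p real matrix and δ ∈ ℝ^p. Then ‖f̄_k‖_∞ − ‖f̄_m‖_∞ = ‖f̄_k − f̄_m‖_∞ ≥ ( 3·(m−k)·θ·(n−k+m) ) / ( 8·√(n·k·(n−k))·m ) · ‖Σδ‖_∞. -/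
open Matrix

/-- To the right of the change point the drift is `θ / j · √(j(n−j)/n) · Σδ`. -/
theorem fbar_eq_of_le {p n θ j : ℕ} (hθ : 1 ≤ θ) (hθj : θ ≤ j) (h : θ < j ∨ j < n)
    (S : Matrix (Fin p) (Fin p) ℝ) (δ : Fin p → ℝ) :
    fbar n θ S δ j =
      ((θ : ℝ) / j * Real.sqrt ((j : ℝ) * ((n : ℝ) - j) / n)) • S.mulVec δ := by
  unfold fbar
  congr 1
  rw [mul_comm]
  congr 1
  split_ifs with hj
  · obtain rfl : j = θ := le_antisymm hj hθj
    have hjn : (j : ℝ) < n := by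
      exact_mod_cast h.resolve_left (lt_irrefl j)
    have hj0 : (j : ℝ) ≠ 0 := by
      exact_mod_cast (by omega : j ≠ 0)
    rw [div_self (sub_ne_zero.mpr hjn.ne'), div_self hj0]
  · rfl

/-- The geometric mean of `k(n−k)` and `m(n−m)` is small when `m − k` is large. -/
theorem sqrt_mul_sqrt_le {n m k : ℝ} (hk : 0 ≤ k) (hkm : k ≤ m) (hmn : m ≤ n) :
    Real.sqrt (k * (n - k) * (m * (n - m))) ≤ (n - k) * m - (m - k) * (n - k + m) / 2 := by
  obtain ⟨d, rfl⟩ : ∃ d, m = k + d := ⟨m - k, by ring⟩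
  obtain ⟨q, rfl⟩ : ∃ q, n = k + d + q := ⟨n - (k + d), by ring⟩
  have hd : 0 ≤ d := by linarith
  have hq : 0 ≤ q := by linarith
  have hX : (k + d + q - k) * (k + d) - (k + d - k) * (k + d + q - k + (k + d)) / 2
      = q * k + d * (k + q) / 2 := by ring
  rw [hX]
  refine Real.sqrt_le_iff.mpr ⟨by positivity, ?_⟩
  linarith [sq_nonneg (d * (k - q))]

/-- Separation of the scalar profile `j ↦ θ / j · √(j(n−j)/n)`. -/
theorem profile_separation {n m k θ : ℝ} (hθ : 0 ≤ θ) (hk : 0 < k) (hkm : k ≤ m) (hmn : m ≤ n)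
    (hkn : k < n) :
    3 * (m - k) * θ * (n - k + m) / (8 * Real.sqrt (n * k * (n - k)) * m) ≤
      θ / k * Real.sqrt (k * (n - k) / n) - θ / m * Real.sqrt (m * (n - m) / n) := by
  have hm : 0 < m := hk.trans_le hkm
  have hn : 0 < n := hk.trans hkn
  have hnk : 0 < n - k := sub_pos.mpr hkn
  have hs : 0 < Real.sqrt (n * k * (n - k)) := Real.sqrt_pos.mpr (by positivity)
  have h₁ : Real.sqrt (n * k * (n - k)) * Real.sqrt (k * (n - k) / n) = k * (n - k) := by
    rw [← Real.sqrt_mul (by positivity),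
      show n * k * (n - k) * (k * (n - k) / n) = (k * (n - k)) ^ 2 by field_simp,
      Real.sqrt_sq (by positivity)]
  have h₂ : Real.sqrt (n * k * (n - k)) * Real.sqrt (m * (n - m) / n) =
      Real.sqrt (k * (n - k) * (m * (n - m))) := by
    rw [← Real.sqrt_mul (by positivity)]
    congr 1
    field_simp
  have h₃ := sqrt_mul_sqrt_le hk.le hkm hmn
  rw [← h₂] at h₃
  set s := Real.sqrt (n * k * (n - k))
  set a := Real.sqrt (k * (n - k) / n)
  set b := Real.sqrt (m * (n - m) / n)
  have hmk : 0 ≤ m - k := sub_nonneg.mpr hkm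
  have hprod : 0 ≤ (m - k) * (n - k + m) := by positivity
  have hb : (θ / k * a - θ / m * b) * (8 * s * m) = 8 * θ * ((n - k) * m - s * b) := by
    have e : (θ / k * a - θ / m * b) * (8 * s * m) = 8 * θ * ((s * a) / k * m - s * b) := by
      field_simp
    rw [e, h₁, mul_div_cancel_left₀ _ hk.ne']
  rw [div_le_iff₀ (by positivity), hb]
  calc 3 * (m - k) * θ * (n - k + m) = 8 * θ * (3 / 8 * ((m - k) * (n - k + m))) := by ring
    _ ≤ 8 * θ * ((n - k) * m - s * b) := by
      gcongr
      linarith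

/-- Separation of the drift of the covariance-scanning statistic, right case:
for `1 ≤ θ ≤ k ≤ m ≤ n`, `k ≤ n − 1`,
`‖f̄_k‖∞ − ‖f̄_m‖∞ = ‖f̄_k − f̄_m‖∞ ≥ 3(m−k)θ(n−k+m)/(8√(nk(n−k))m) · ‖Σδ‖∞`,
where `‖·‖` denotes the coordinatewise maximum absolute value (the sup norm on `ℝ^p`). -/
theorem fbar_separation_right (p n m k θ : ℕ) (hθ : 1 ≤ θ) (hθk : θ ≤ k) (hkm : k ≤ m)
    (hmn : m ≤ n) (hk : k ≤ n - 1) (S : Matrix (Fin p) (Fin p) ℝ) (δ : Fin p → ℝ) :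
    ‖fbar n θ S δ k‖ - ‖fbar n θ S δ m‖ = ‖fbar n θ S δ k - fbar n θ S δ m‖ ∧
      3 * ((m : ℝ) - k) * (θ : ℝ) * ((n : ℝ) - k + m) /
          (8 * Real.sqrt ((n : ℝ) * k * ((n : ℝ) - k)) * (m : ℝ)) * ‖S.mulVec δ‖
        ≤ ‖fbar n θ S δ k - fbar n θ S δ m‖ := by
  have hθ' : (0 : ℝ) ≤ θ := Nat.cast_nonneg θ
  have hk' : (0 : ℝ) < k := by exact_mod_cast (by omega : 0 < k)
  have hm' : (k : ℝ) ≤ m := by exact_mod_cast hkm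
  have hmn' : (m : ℝ) ≤ n := by exact_mod_cast hmn
  have hkn' : (k : ℝ) < n := by exact_mod_cast (by omega : k < n)
  have hsep := profile_separation hθ' hk' hm' hmn' hkn'
  have hlow : 0 ≤ 3 * ((m : ℝ) - k) * (θ : ℝ) * ((n : ℝ) - k + m) /
      (8 * Real.sqrt ((n : ℝ) * k * ((n : ℝ) - k)) * (m : ℝ)) := by
    have h₁ : (0 : ℝ) ≤ m - k := sub_nonneg.mpr hm'
    have h₂ : (0 : ℝ) ≤ n - k := sub_nonneg.mpr hkn'.le
    positivity
  rw [fbar_eq_of_le hθ hθk (by omega), fbar_eq_of_le hθ (hθk.trans hkm) (by omega), ← sub_smul,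
    norm_smul, norm_smul, norm_smul, Real.norm_of_nonneg (by positivity),
    Real.norm_of_nonneg (by positivity), Real.norm_of_nonneg (hlow.trans hsep)]
  exact ⟨(sub_mul _ _ _).symm, by gcongr⟩
end

section
/- Drift increment identity for the quadratic scanning statistic, left case (Lemma B.7/lem:f, first identity). Let n, m, k, θ be integers with 1 ≤ m ≤ k ≤ θ ≤ n and k ≤ n − 1, let Σ be a p×p real symmetric matrix, and let β₀, β₁ ∈ ℝ^p with δ = β₁ − β₀. Then f_k − f_m = ( (k−m)·(n−θ) / ((n−k)·(n−m)) ) · ( (n−θ)·‖Σδ‖₂² − ‖Σβ₀‖₂² + ‖Σβ₁‖₂² ). -/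
open Matrix

/-- Squared Euclidean (ℓ₂) norm of a vector in `ℝ^p`. -/
def sqnorm2 {p : ℕ} (v : Fin p → ℝ) : ℝ := ∑ i, v i ^ 2

/-- The drift of the quadratic covariance-scanning statistic:
`f_k = (k(n−k)/n)·[ ((n−θ)²/(n−k)²·𝟙{k ≤ θ} + θ²/k²·𝟙{k > θ})·δᵀΣ²δ
  − ((θ−k)/(n−k)²·𝟙{k ≤ θ} − (k−θ)/k²·𝟙{k > θ})·δᵀΣ²(β₀+β₁)
  + (1/k)·β₀ᵀΣ²β₀ + (1/(n−k))·β₁ᵀΣ²β₁ ]`. -/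
noncomputable def fdrift {p : ℕ} (n θ : ℕ) (S : Matrix (Fin p) (Fin p) ℝ)
    (β₀ β₁ : Fin p → ℝ) (k : ℕ) : ℝ :=
  ((k : ℝ) * ((n : ℝ) - k) / n) *
    (((if k ≤ θ then ((n : ℝ) - θ) ^ 2 / ((n : ℝ) - k) ^ 2 else 0) +
        (if θ < k then (θ : ℝ) ^ 2 / (k : ℝ) ^ 2 else 0)) *
        ((β₁ - β₀) ⬝ᵥ (S * S).mulVec (β₁ - β₀))
      - ((if k ≤ θ then ((θ : ℝ) - k) / ((n : ℝ) - k) ^ 2 else 0) -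
          (if θ < k then ((k : ℝ) - θ) / (k : ℝ) ^ 2 else 0)) *
          ((β₁ - β₀) ⬝ᵥ (S * S).mulVec (β₀ + β₁))
      + (1 / (k : ℝ)) * (β₀ ⬝ᵥ (S * S).mulVec β₀)
      + (1 / ((n : ℝ) - k)) * (β₁ ⬝ᵥ (S * S).mulVec β₁))

theorem dotProduct_mul_self_mulVec {p : ℕ} {S : Matrix (Fin p) (Fin p) ℝ} (hS : S.IsSymm)
    (u v : Fin p → ℝ) : u ⬝ᵥ (S * S).mulVec v = S.mulVec u ⬝ᵥ S.mulVec v := by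
  rw [← mulVec_mulVec, dotProduct_mulVec, ← mulVec_transpose, hS.eq]

theorem sqnorm2_eq_dotProduct {p : ℕ} (v : Fin p → ℝ) : sqnorm2 v = v ⬝ᵥ v := by
  simp only [sqnorm2, dotProduct, sq]

/-- To the left of the change point, the drift is an affine function of `k / (n - k)`. -/
theorem fdrift_eq_of_le {p n θ k : ℕ} {S : Matrix (Fin p) (Fin p) ℝ} (hS : S.IsSymm)
    (β₀ β₁ : Fin p → ℝ) (hk : 1 ≤ k) (hkθ : k ≤ θ) (hkn : k < n) :
    fdrift n θ S β₀ β₁ k = sqnorm2 (S.mulVec β₀) +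
      (k : ℝ) * ((n : ℝ) - θ) / (n * ((n : ℝ) - k)) *
        (((n : ℝ) - θ) * sqnorm2 (S.mulVec (β₁ - β₀))
          - sqnorm2 (S.mulVec β₀) + sqnorm2 (S.mulVec β₁)) := by
  have hk0 : (k : ℝ) ≠ 0 := by positivity
  have hn0 : (n : ℝ) ≠ 0 := by exact_mod_cast (by omega : n ≠ 0)
  have hnk : (n : ℝ) - k ≠ 0 := sub_ne_zero.mpr (by exact_mod_cast hkn.ne')
  have hcross : (β₁ - β₀) ⬝ᵥ (S * S).mulVec (β₀ + β₁) =
      sqnorm2 (S.mulVec β₁) - sqnorm2 (S.mulVec β₀) := by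
    simp only [dotProduct_mul_self_mulVec hS, sqnorm2_eq_dotProduct, mulVec_sub, mulVec_add,
      sub_dotProduct, dotProduct_add, dotProduct_comm (S.mulVec β₁) (S.mulVec β₀)]
    ring
  simp only [fdrift, if_pos hkθ, if_neg hkθ.not_gt, hcross]
  simp only [dotProduct_mul_self_mulVec hS, ← sqnorm2_eq_dotProduct]
  field_simp
  ring

/-- Drift increment identity for the quadratic scanning statistic, left case:
for `1 ≤ m ≤ k ≤ θ ≤ n`, `k ≤ n−1` and symmetric `Σ`,
`f_k − f_m = ((k−m)(n−θ)/((n−k)(n−m)))·((n−θ)‖Σδ‖₂² − ‖Σβ₀‖₂² + ‖Σβ₁‖₂²)`. -/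
theorem fdrift_increment_left (p n m k θ : ℕ) (S : Matrix (Fin p) (Fin p) ℝ)
    (hS : S.IsSymm) (β₀ β₁ : Fin p → ℝ)
    (hm : 1 ≤ m) (hmk : m ≤ k) (hkθ : k ≤ θ) (hθn : θ ≤ n) (hk : k ≤ n - 1) :
    fdrift n θ S β₀ β₁ k - fdrift n θ S β₀ β₁ m
      = ((k : ℝ) - m) * ((n : ℝ) - θ) / (((n : ℝ) - k) * ((n : ℝ) - m)) *
          (((n : ℝ) - θ) * sqnorm2 (S.mulVec (β₁ - β₀))
            - sqnorm2 (S.mulVec β₀) + sqnorm2 (S.mulVec β₁)) := by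
  have hkn : k < n := by omega
  have hn0 : (n : ℝ) ≠ 0 := by exact_mod_cast (by omega : n ≠ 0)
  have hnk : (n : ℝ) - k ≠ 0 := sub_ne_zero.mpr (by exact_mod_cast hkn.ne')
  have hnm : (n : ℝ) - m ≠ 0 := sub_ne_zero.mpr (by exact_mod_cast (hmk.trans_lt hkn).ne')
  rw [fdrift_eq_of_le hS β₀ β₁ (hm.trans hmk) hkθ hkn,
    fdrift_eq_of_le hS β₀ β₁ hm (hmk.trans hkθ) (hmk.trans_lt hkn)]
  field_simp
  ring
end

section
/- Cumulative-sum representation of the QcScan detector statistic (Section 4.3). Let n ≥ 2 and 1 ≤ k ≤ n−1 be integers, let x_1,…,x_n ∈ ℝ^p and Y_1,…,Y_n ∈ ℝ, and set S_j = Σ_{t=1}^j x_t·Y_t ∈ ℝ^p, r_j = Σ_{t=1}^j Y_t² for 0 ≤ j ≤ n, and a₀ = (1/n)·Σ_{t=1}^n ‖x_t‖₂². Then the QcScan statistic T_k := ‖Σ_{t=1}^n Ỹ_t(k)·x_t‖₂² − a₀·Σ_{t=1}^n Ỹ_t(k)² satisfies T_k = ( n / (k·(n−k)) )·‖ S_k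 − (k/n)·S_n ‖₂² − a₀·( ((n−2k)/(k·(n−k)))·r_k + (k/(n·(n−k)))·r_n ). -/
/-- Weights `Ỹ_t(k)`: `−√((n−k)/(nk))·Y_t` for `t ≤ k` and `√(k/(n(n−k)))·Y_t` for `t > k`
(`t : Fin n` represents the time point `t + 1 ∈ {1,…,n}`). -/
noncomputable def ytil (n : ℕ) (Y : Fin n → ℝ) (k : ℕ) (t : Fin n) : ℝ :=
  if (t : ℕ) < k then -(Real.sqrt (((n : ℝ) - k) / ((n : ℝ) * k)) * Y t)
  else Real.sqrt ((k : ℝ) / ((n : ℝ) * ((n : ℝ) - k))) * Y t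

/-- Cumulative sums `S_j = Σ_{t=1}^j Y_t·x_t ∈ ℝ^p`. -/
def cusum {n p : ℕ} (x : Fin n → Fin p → ℝ) (Y : Fin n → ℝ) (j : ℕ) : Fin p → ℝ :=
  ∑ t ∈ Finset.univ.filter (fun t : Fin n => (t : ℕ) < j), Y t • x t

/-- Cumulative sums of squared responses `r_j = Σ_{t=1}^j Y_t²`. -/
def rsum {n : ℕ} (Y : Fin n → ℝ) (j : ℕ) : ℝ :=
  ∑ t ∈ Finset.univ.filter (fun t : Fin n => (t : ℕ) < j), Y t ^ 2

theorem ytil_eq {n k : ℕ} (hk0 : 0 < k) (hkn : k < n) (Y : Fin n → ℝ) (t : Fin n) :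
    ytil n Y k t = √((n : ℝ) / ((k : ℝ) * ((n : ℝ) - k))) *
      ((k : ℝ) / n * Y t - if (t : ℕ) < k then Y t else 0) := by
  have hk : (0 : ℝ) < k := by exact_mod_cast hk0
  have hnk : (0 : ℝ) < (n : ℝ) - k := sub_pos.mpr (by exact_mod_cast hkn)
  have hn : (0 : ℝ) < n := by linarith
  have hleft : √(((n : ℝ) - k) / ((n : ℝ) * k))
      = √((n : ℝ) / ((k : ℝ) * ((n : ℝ) - k))) * (((n : ℝ) - k) / n) := by
    rw [← Real.sqrt_sq (div_pos hnk hn).le, ← Real.sqrt_mul (by positivity)]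
    congr 1
    field_simp
  have hright : √((k : ℝ) / ((n : ℝ) * ((n : ℝ) - k)))
      = √((n : ℝ) / ((k : ℝ) * ((n : ℝ) - k))) * ((k : ℝ) / n) := by
    rw [← Real.sqrt_sq (div_pos hk hn).le, ← Real.sqrt_mul (by positivity)]
    congr 1
    field_simp
  unfold ytil
  split_ifs
  · rw [hleft]
    field_simp
    ring
  · rw [hright]
    ring

theorem ytil_sq {n k : ℕ} (hk0 : 0 < k) (hkn : k < n) (Y : Fin n → ℝ) (t : Fin n) :
    ytil n Y k t ^ 2 =
      ((n : ℝ) - 2 * k) / ((k : ℝ) * ((n : ℝ) - k)) * (if (t : ℕ) < k then Y t ^ 2 else 0)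
        + (k : ℝ) / ((n : ℝ) * ((n : ℝ) - k)) * Y t ^ 2 := by
  have hk : (0 : ℝ) < k := by exact_mod_cast hk0
  have hnk : (0 : ℝ) < (n : ℝ) - k := sub_pos.mpr (by exact_mod_cast hkn)
  have hn : (0 : ℝ) < n := by linarith
  rw [ytil_eq hk0 hkn, mul_pow, Real.sq_sqrt (by positivity)]
  split_ifs <;> field_simp <;> ring

theorem cusum_eq_sum {n p : ℕ} (x : Fin n → Fin p → ℝ) (Y : Fin n → ℝ) :
    cusum x Y n = ∑ t, Y t • x t := by
  simp [cusum]

theorem rsum_eq_sum {n : ℕ} (Y : Fin n → ℝ) : rsum Y n = ∑ t, Y t ^ 2 := by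
  simp [rsum]

theorem sqnorm2_smul {p : ℕ} (c : ℝ) (v : Fin p → ℝ) : sqnorm2 (c • v) = c ^ 2 * sqnorm2 v := by
  simp [sqnorm2, mul_pow, Finset.mul_sum]

theorem sum_ytil_smul {n p k : ℕ} (hk0 : 0 < k) (hkn : k < n) (x : Fin n → Fin p → ℝ)
    (Y : Fin n → ℝ) :
    ∑ t, ytil n Y k t • x t = (-√((n : ℝ) / ((k : ℝ) * ((n : ℝ) - k)))) •
      (cusum x Y k - ((k : ℝ) / n) • cusum x Y n) := by
  rw [cusum_eq_sum, cusum, Finset.sum_filter, Finset.smul_sum, ← Finset.sum_sub_distrib,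
    Finset.smul_sum]
  refine Finset.sum_congr rfl fun t _ => ?_
  rw [ytil_eq hk0 hkn]
  split_ifs <;> module

theorem sum_ytil_sq {n k : ℕ} (hk0 : 0 < k) (hkn : k < n) (Y : Fin n → ℝ) :
    ∑ t, ytil n Y k t ^ 2 =
      ((n : ℝ) - 2 * k) / ((k : ℝ) * ((n : ℝ) - k)) * rsum Y k
        + (k : ℝ) / ((n : ℝ) * ((n : ℝ) - k)) * rsum Y n := by
  rw [rsum_eq_sum, rsum, Finset.sum_filter, Finset.mul_sum, Finset.mul_sum,
    ← Finset.sum_add_distrib]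
  exact Finset.sum_congr rfl fun t _ => ytil_sq hk0 hkn Y t

/-- Cumulative-sum representation of the QcScan detector statistic:
with `a₀ = (1/n)·Σ_t ‖x_t‖₂²`, the statistic
`T_k = ‖Σ_t Ỹ_t(k)·x_t‖₂² − a₀·Σ_t Ỹ_t(k)²` satisfies
`T_k = (n/(k(n−k)))·‖S_k − (k/n)·S_n‖₂²
  − a₀·(((n−2k)/(k(n−k)))·r_k + (k/(n(n−k)))·r_n)`. -/
theorem qcscan_cusum_representation (n p k : ℕ) (hn : 2 ≤ n) (hk1 : 1 ≤ k) (hk : k ≤ n - 1)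
    (x : Fin n → Fin p → ℝ) (Y : Fin n → ℝ) :
    sqnorm2 (∑ t, ytil n Y k t • x t)
        - ((1 / (n : ℝ)) * ∑ t, sqnorm2 (x t)) * ∑ t, (ytil n Y k t) ^ 2
      = ((n : ℝ) / ((k : ℝ) * ((n : ℝ) - k))) *
            sqnorm2 (cusum x Y k - ((k : ℝ) / n) • cusum x Y n)
          - ((1 / (n : ℝ)) * ∑ t, sqnorm2 (x t)) *
              ((((n : ℝ) - 2 * k) / ((k : ℝ) * ((n : ℝ) - k))) * rsum Y k
                + ((k : ℝ) / ((n : ℝ) * ((n : ℝ) - k))) * rsum Y n) := by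
  have hkn : k < n := by omega
  have hnk : (0 : ℝ) ≤ (n : ℝ) - k := sub_nonneg.mpr (by exact_mod_cast hkn.le)
  rw [sum_ytil_smul hk1 hkn, sum_ytil_sq hk1 hkn, sqnorm2_smul, neg_sq,
    Real.sq_sqrt (by positivity)]
end

section
/- Sparse-regime lower bound on the sup-norm of the covariance-weighted change (Section 3.1). Let Σ be a p×p real positive semidefinite matrix and σ_* > 0 such that every eigenvalue of Σ is either 0 or at least σ_*. Let Σ^{1/2} be the positive semidefinite square root of Σ, let δ ∈ ℝ^p with Σ^{1/2}δ ≠ 0, and let 𝔰 denote the number of nonzero coordinates of Σ^{1/2}δ. Then ‖Σδ‖_∞ ≥ ( δᵀ Σ Σ^{1/2} δ ) / ‖Σ^{1/2}δ‖₁ ≥ σ_*^{1/2} · ‖Σ^{1/2}δ‖₂ / 𝔰^{1/2}. -/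
open Matrix

/-- If every eigenvalue of the square of a positive semidefinite matrix `H` is `0` or at least
`c`, then the quadratic form of `H` at a vector in the range of `H` is bounded below by `√c` times
its squared Euclidean norm. -/
theorem Matrix.PosSemidef.sqrt_mul_dotProduct_le {n : Type*} [Fintype n] [DecidableEq n]
    {H : Matrix n n ℝ} (hH : H.PosSemidef) {c : ℝ}
    (heig : ∀ μ ∈ spectrum ℝ (H * H), μ = 0 ∨ c ≤ μ) (x : n → ℝ) :
    √c * (H *ᵥ x ⬝ᵥ H *ᵥ x) ≤ H *ᵥ x ⬝ᵥ H *ᵥ (H *ᵥ x) := by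
  have hherm := hH.isHermitian
  have hgap : ∀ i, hherm.eigenvalues i = 0 ∨ √c ≤ hherm.eigenvalues i := by
    intro i
    have hmem := spectrum.pow_mem_pow H 2 (hherm.eigenvalues_mem_spectrum_real i)
    rw [pow_two H] at hmem
    rcases heig _ hmem with h | h
    · exact Or.inl (pow_eq_zero_iff two_ne_zero |>.mp h)
    · exact Or.inr (Real.sqrt_le_iff.mpr ⟨hH.eigenvalues_nonneg i, h⟩)
  set U : Matrix n n ℝ := (hherm.eigenvectorUnitary : Matrix n n ℝ)
  have hUU : Uᵀ * U = 1 := by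
    simpa [star_eq_conjTranspose] using Unitary.coe_star_mul_self hherm.eigenvectorUnitary
  have hspec : H = U * diagonal hherm.eigenvalues * Uᵀ := by
    have := hherm.spectral_theorem
    simpa [Unitary.conjStarAlgAut_apply, star_eq_conjTranspose, Function.comp_def] using this
  set d := hherm.eigenvalues
  set w := Uᵀ *ᵥ x with hw
  have hHx : H *ᵥ x = U *ᵥ (diagonal d *ᵥ w) := by
    rw [hspec]; simp [hw, mulVec_mulVec, Matrix.mul_assoc]
  have hHHx : H *ᵥ (H *ᵥ x) = U *ᵥ (diagonal d *ᵥ (diagonal d *ᵥ w)) := by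
    rw [hHx]
    nth_rewrite 1 [hspec]
    rw [← mulVec_mulVec, ← mulVec_mulVec, mulVec_mulVec _ Uᵀ U, hUU, one_mulVec]
  have hiso : ∀ a b : n → ℝ, U *ᵥ a ⬝ᵥ U *ᵥ b = a ⬝ᵥ b := by
    intro a b
    rw [dotProduct_mulVec, vecMul_mulVec, hUU, vecMul_one]
  rw [hHHx, hHx, hiso, hiso]
  simp only [dotProduct, mulVec_diagonal, Finset.mul_sum]
  refine Finset.sum_le_sum fun i _ => ?_
  rcases hgap i with h | h
  · simp [h]
  · nlinarith [mul_le_mul_of_nonneg_right h (sq_nonneg (d i * w i))]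

/-- Hölder's inequality for the pairing of `ℓ₁` with `ℓ_∞`. -/
theorem dotProduct_le_sum_abs_mul_norm {n : Type*} [Fintype n] (v w : n → ℝ) :
    v ⬝ᵥ w ≤ (∑ i, |v i|) * ‖w‖ := by
  rw [dotProduct, Finset.sum_mul]
  refine Finset.sum_le_sum fun i _ => (le_abs_self _).trans ?_
  rw [abs_mul]
  exact mul_le_mul_of_nonneg_left (norm_le_pi_norm w i) (abs_nonneg _)

/-- The `ℓ₁` norm is at most the `ℓ₂` norm times the square root of the number of nonzero
coordinates. -/
theorem sum_abs_le_sqrt_ncard_support_mul_l2norm {p : ℕ} (v : Fin p → ℝ) :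
    ∑ i, |v i| ≤ √(Function.support v).ncard * l2norm v := by
  classical
  have hcard : (Function.support v).ncard = (Finset.univ.filter fun i => v i ≠ 0).card := by
    rw [← Set.ncard_coe_finset]; congr; ext; simp
  have h₁ : ∑ i, |v i| = ∑ i with v i ≠ 0, |v i| :=
    (Finset.sum_filter_of_ne fun i _ h => by simpa using h).symm
  have h₂ : ∑ i, v i ^ 2 = ∑ i with v i ≠ 0, |v i| ^ 2 := by
    simp only [sq_abs]
    exact (Finset.sum_filter_of_ne fun i _ h => by simpa using h).symm
  rw [l2norm, ← Real.sqrt_mul (Nat.cast_nonneg _), hcard, h₁, h₂]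
  exact Real.le_sqrt_of_sq_le sq_sum_le_card_mul_sum_sq

/-- Sparse-regime lower bound on the sup-norm of the covariance-weighted change:
if `Σ` is positive semidefinite with positive semidefinite square root `Σ^{1/2}`,
every eigenvalue of `Σ` is either `0` or at least `σ_* > 0`, and `Σ^{1/2}δ ≠ 0` has
`𝔰` nonzero coordinates, then
`‖Σδ‖∞ ≥ (δᵀΣΣ^{1/2}δ)/‖Σ^{1/2}δ‖₁ ≥ √σ_*·‖Σ^{1/2}δ‖₂/√𝔰`,
where `‖·‖` on the left-hand side is the coordinatewise maximum absolute value. -/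
theorem sparse_regime_lower_bound (p : ℕ) (S Shalf : Matrix (Fin p) (Fin p) ℝ)
    (hS : S.PosSemidef) (hShalf : Shalf.PosSemidef) (hsq : Shalf * Shalf = S)
    (σs : ℝ) (hσs : 0 < σs)
    (heig : ∀ μ ∈ spectrum ℝ S, μ = 0 ∨ σs ≤ μ)
    (δ : Fin p → ℝ) (hδ : Shalf.mulVec δ ≠ 0) :
    Real.sqrt σs * l2norm (Shalf.mulVec δ) /
          Real.sqrt ((Function.support (Shalf.mulVec δ)).ncard)
        ≤ (δ ⬝ᵥ (S * Shalf).mulVec δ) / (∑ i, |Shalf.mulVec δ i|) ∧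
      (δ ⬝ᵥ (S * Shalf).mulVec δ) / (∑ i, |Shalf.mulVec δ i|) ≤ ‖S.mulVec δ‖ := by
  set v := Shalf *ᵥ δ
  have hT : Shalfᵀ = Shalf := by simpa using hShalf.isHermitian.eq
  have hmove : ∀ y, δ ⬝ᵥ Shalf *ᵥ y = v ⬝ᵥ y := by
    intro y
    rw [dotProduct_mulVec, ← mulVec_transpose, hT]
  have hSv : S *ᵥ δ = Shalf *ᵥ v := by rw [← hsq, ← mulVec_mulVec]
  have hnum : δ ⬝ᵥ (S * Shalf) *ᵥ δ = v ⬝ᵥ Shalf *ᵥ v := by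
    rw [← hsq, ← mulVec_mulVec, ← mulVec_mulVec, hmove]
  obtain ⟨j, hj⟩ := Function.ne_iff.mp hδ
  have hpos : 0 < ∑ i, |v i| :=
    Finset.sum_pos' (fun i _ => abs_nonneg _) ⟨j, Finset.mem_univ j, abs_pos.mpr hj⟩
  rw [hnum, hSv]
  refine ⟨?_, (div_le_iff₀' hpos).mpr (dotProduct_le_sum_abs_mul_norm _ _)⟩
  have hcard : 0 < √((Function.support v).ncard : ℝ) := by
    rw [Real.sqrt_pos, Nat.cast_pos]
    exact (Set.ncard_pos (Set.toFinite _)).mpr ⟨j, hj⟩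
  have hl2 : l2norm v * l2norm v = v ⬝ᵥ v := by
    rw [l2norm, Real.mul_self_sqrt (Finset.sum_nonneg fun i _ => sq_nonneg _)]
    simp only [dotProduct, pow_two]
  have hnonneg : 0 ≤ √σs * l2norm v := mul_nonneg (Real.sqrt_nonneg _) (Real.sqrt_nonneg _)
  rw [div_le_div_iff₀ hcard hpos]
  calc √σs * l2norm v * ∑ i, |v i|
      ≤ √σs * l2norm v * (√(Function.support v).ncard * l2norm v) :=
        mul_le_mul_of_nonneg_left (sum_abs_le_sqrt_ncard_support_mul_l2norm v) hnonneg
    _ = √σs * (v ⬝ᵥ v) * √(Function.support v).ncard := by rw [← hl2]; ring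
    _ ≤ (v ⬝ᵥ Shalf *ᵥ v) * √(Function.support v).ncard :=
        mul_le_mul_of_nonneg_right
          (hShalf.sqrt_mul_dotProduct_le (by rwa [hsq]) δ) hcard.le
end
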